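/- arXiv:0912.3670 — 2 statements merged into one kernel-verified Lean document; each statement's English description precedes it below -/
import Mathlib

section
/- Let n ≥ 1 and y > 1. For every real trigonometric polynomial f of degree n with leading harmonic y cos(nt) (i.e., f(t) = y cos nt + g(t) with g of degree ≤ n−1), the Lebesgue measure of { t ∈ [0, 2π) : |f(t)| ≥ 1 } is at least 4 arccos( y^{−1/(2n)} ), and this bound is attained by f(t) = T_n( y^{1/n} cos t − y^{1/n} + 1 ). -/
open Real MeasureTheory Polynomial

open scoped ComplexConjugate

/-- The Herglotz kernel `(e^{it} + z) / (e^{it} - z)` of the unit circle. -/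
noncomputable def circleKernel (z : ℂ) (t : ℝ) : ℂ :=
  (Complex.exp (t * Complex.I) + z) / (Complex.exp (t * Complex.I) - z)

/-- The Herglotz transform of the part of the unit circle with arguments in `E`. -/
noncomputable def herglotzTransform (E : Set ℝ) (z : ℂ) : ℂ :=
  ∫ t in E, circleKernel z t

lemma measurable_circleKernel (z : ℂ) : Measurable (circleKernel z) := by
  unfold circleKernel
  fun_prop

lemma re_circleKernel (z : ℂ) (t : ℝ) :
    (circleKernel z t).re =
      (1 - ‖z‖ ^ 2) / ‖Complex.exp (t * Complex.I) - z‖ ^ 2 := by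
  have h1 : Complex.normSq (Complex.exp (t * Complex.I)) = 1 := by
    rw [Complex.normSq_eq_norm_sq, Complex.norm_exp_ofReal_mul_I, one_pow]
  rw [circleKernel, Complex.div_re, ← Complex.normSq_eq_norm_sq, ← Complex.normSq_eq_norm_sq,
    ← add_div, ← h1]
  congr 1
  simp only [Complex.normSq_apply, Complex.add_re, Complex.sub_re, Complex.add_im, Complex.sub_im]
  ring

lemma re_circleKernel_inv_conj {z : ℂ} (hz : z ≠ 0) (t : ℝ) :
    (circleKernel (conj z)⁻¹ t).re = -(circleKernel z t).re := by
  have h1 : Complex.exp (t * Complex.I) * conj (Complex.exp (t * Complex.I)) = 1 := by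
    rw [Complex.mul_conj, Complex.normSq_eq_norm_sq, Complex.norm_exp_ofReal_mul_I]
    simp
  have hz' : conj z ≠ 0 := by simpa using hz
  have h : circleKernel (conj z)⁻¹ t = -conj (circleKernel z t) := by
    unfold circleKernel
    set e := Complex.exp (t * Complex.I)
    have he : conj e ≠ 0 := right_ne_zero_of_mul_eq_one h1
    rw [map_div₀, map_add, map_sub, ← div_neg, neg_sub,
      ← mul_div_mul_right (e + _) _ (mul_ne_zero hz' he)]
    congr 1
    · linear_combination (conj z) * h1 + conj e * inv_mul_cancel₀ hz'
    · linear_combination (conj z) * h1 - conj e * inv_mul_cancel₀ hz'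
  rw [h, Complex.neg_re, Complex.conj_re]

lemma integral_re_circleKernel {z : ℂ} (hz : ‖z‖ < 1) :
    ∫ t in (0 : ℝ)..2 * π, (circleKernel z t).re = 2 * π := by
  have hd : DiffContOnCl ℂ (fun _ : ℂ ↦ (1 : ℂ)) (Metric.ball 0 1) := diffContOnCl_const
  have h := hd.circleAverage_re_herglotzRieszKernel_smul (w := z) (by simpa using hz)
  have heq : ∀ t : ℝ, ((Complex.re ∘ herglotzRieszKernel 0 z) • fun _ ↦ (1 : ℂ)) (circleMap 0 1 t) =
      ((circleKernel z t).re : ℂ) := fun t ↦ by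
    simp [herglotzRieszKernel_def, circleKernel, circleMap]
  simp only [circleAverage_def, heq, intervalIntegral.integral_ofReal, Complex.real_smul] at h
  have h2 : (2 * π)⁻¹ * ∫ t in (0 : ℝ)..2 * π, (circleKernel z t).re = 1 := by
    exact_mod_cast h
  rwa [inv_mul_eq_one₀ (by positivity), eq_comm] at h2

lemma continuous_re_circleKernel {z : ℂ} (hz : ‖z‖ ≠ 1) :
    Continuous fun t ↦ (circleKernel z t).re := by
  unfold circleKernel
  refine Complex.continuous_re.comp (Continuous.div (by fun_prop) (by fun_prop) fun t h ↦ hz ?_)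
  rw [← sub_eq_zero.1 h, Complex.norm_exp_ofReal_mul_I]

lemma integrableOn_circleKernel {E : Set ℝ} (hE : MeasurableSet E) (hEf : volume E < ⊤) {z : ℂ}
    {δ : ℝ} (hδ : 0 < δ) (h : ∀ t ∈ E, δ ≤ ‖Complex.exp (t * Complex.I) - z‖) :
    IntegrableOn (circleKernel z) E := by
  refine Measure.integrableOn_of_bounded (M := (1 + ‖z‖) / δ) hEf.ne
    (measurable_circleKernel z).aestronglyMeasurable ?_
  filter_upwards [ae_restrict_mem hE] with t ht
  rw [circleKernel, norm_div]
  gcongr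
  · exact (norm_add_le _ _).trans (by rw [Complex.norm_exp_ofReal_mul_I])
  · exact h t ht

lemma setIntegral_re_circleKernel_mem {E : Set ℝ} (hE : E ⊆ Set.Icc 0 (2 * π)) {z : ℂ}
    (hz : ‖z‖ < 1) : (∫ t in E, (circleKernel z t).re) ∈ Set.Icc 0 (2 * π) := by
  have h0 : ∀ t, 0 ≤ (circleKernel z t).re := fun t ↦ by
    rw [re_circleKernel]
    exact div_nonneg (by nlinarith [norm_nonneg z]) (sq_nonneg _)
  refine ⟨integral_nonneg h0, ?_⟩
  rw [← integral_re_circleKernel hz, intervalIntegral.integral_of_le (by positivity),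
    ← integral_Icc_eq_integral_Ioc]
  exact setIntegral_mono_set ((continuous_re_circleKernel hz.ne).integrableOn_Icc)
    (Filter.Eventually.of_forall h0) hE.eventuallyLE

lemma abs_re_herglotzTransform_le {E : Set ℝ} (hE : MeasurableSet E)
    (hE' : E ⊆ Set.Icc 0 (2 * π)) {z : ℂ} {δ : ℝ} (hδ : 0 < δ)
    (h : ∀ t ∈ E, δ ≤ ‖Complex.exp (t * Complex.I) - z‖) :
    |(herglotzTransform E z).re| ≤ 2 * π := by
  have hEf : volume E < ⊤ := (measure_mono hE').trans_lt measure_Icc_lt_top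
  have hre : (herglotzTransform E z).re = ∫ t in E, (circleKernel z t).re :=
    (integral_re (integrableOn_circleKernel hE hEf hδ h)).symm
  rw [hre]
  rcases lt_trichotomy ‖z‖ 1 with hz | hz | hz
  · obtain ⟨h1, h2⟩ := setIntegral_re_circleKernel_mem hE' hz
    rwa [abs_of_nonneg h1]
  · simp only [re_circleKernel, hz]
    simp [pi_pos.le]
  · have hz0 : z ≠ 0 := by
      rintro rfl
      norm_num at hz
    have hz' : ‖(conj z)⁻¹‖ < 1 := by
      rw [norm_inv, RCLike.norm_conj]
      exact inv_lt_one_of_one_lt₀ hz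
    obtain ⟨h1, h2⟩ := setIntegral_re_circleKernel_mem hE' hz'
    simp only [re_circleKernel_inv_conj hz0, integral_neg] at h1 h2
    rw [abs_le]
    constructor <;> linarith [pi_pos]

lemma differentiableAt_herglotzTransform {E : Set ℝ} (hE : MeasurableSet E)
    (hEf : volume E < ⊤) {z : ℂ} {δ : ℝ} (hδ : 0 < δ)
    (h : ∀ t ∈ E, δ ≤ ‖Complex.exp (t * Complex.I) - z‖) :
    DifferentiableAt ℂ (herglotzTransform E) z := by
  have hball : ∀ t ∈ E, ∀ w ∈ Metric.ball z (δ / 2),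
      δ / 2 ≤ ‖Complex.exp (t * Complex.I) - w‖ := by
    intro t ht w hw
    have h1 := h t ht
    rw [Metric.mem_ball, dist_eq_norm] at hw
    have h2 := norm_add_le (Complex.exp (t * Complex.I) - w) (w - z)
    rw [sub_add_sub_cancel] at h2
    linarith
  refine (hasDerivAt_integral_of_dominated_loc_of_deriv_le (μ := volume.restrict E)
    (F' := fun w t ↦ 2 * Complex.exp (t * Complex.I) / (Complex.exp (t * Complex.I) - w) ^ 2)
    (bound := fun _ ↦ 2 / (δ / 2) ^ 2)
    (Metric.ball_mem_nhds z (half_pos hδ))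
    (Filter.Eventually.of_forall fun w ↦ (measurable_circleKernel w).aestronglyMeasurable)
    (integrableOn_circleKernel hE hEf hδ h) ?_ ?_ ?_ ?_).2.differentiableAt
  · exact Measurable.aestronglyMeasurable (by fun_prop)
  · filter_upwards [ae_restrict_mem hE] with t ht w hw
    rw [norm_div, norm_mul, norm_pow, Complex.norm_exp_ofReal_mul_I, Complex.norm_two, mul_one]
    gcongr
    exact hball t ht w hw
  · exact integrableOn_const hEf.ne
  · filter_upwards [ae_restrict_mem hE] with t ht w hw
    have hne : Complex.exp (t * Complex.I) - w ≠ 0 :=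
      norm_pos_iff.1 ((half_pos hδ).trans_le (hball t ht w hw))
    refine (((hasDerivAt_id w).const_add (Complex.exp (t * Complex.I))).div
      ((hasDerivAt_id w).const_sub (Complex.exp (t * Complex.I))) hne).congr_deriv ?_
    simp only [id]
    ring

lemma herglotzTransform_zero (E : Set ℝ) : herglotzTransform E 0 = (volume.real E : ℂ) := by
  simp [herglotzTransform, circleKernel, Complex.exp_ne_zero]

lemma norm_herglotzTransform_add_le {E : Set ℝ} (hE : MeasurableSet E)
    (hE' : E ⊆ Set.Icc 0 (2 * π)) {z : ℂ} (hz : 2 ≤ ‖z‖) :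
    ‖herglotzTransform E z + (volume.real E : ℂ)‖ ≤ 8 * π / ‖z‖ := by
  have hEf : volume E < ⊤ := (measure_mono hE').trans_lt measure_Icc_lt_top
  have hvol : volume.real E ≤ 2 * π := by
    simpa [pi_pos.le] using measureReal_mono (μ := volume) hE' measure_Icc_lt_top.ne
  have hsep : ∀ t : ℝ, ‖z‖ / 2 ≤ ‖Complex.exp (t * Complex.I) - z‖ := fun t ↦ by
    have := norm_sub_norm_le z (Complex.exp (t * Complex.I))
    rw [Complex.norm_exp_ofReal_mul_I, norm_sub_rev] at this
    linarith
  have hpos : 0 < ‖z‖ / 2 := by linarith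
  have heq : herglotzTransform E z + (volume.real E : ℂ) = ∫ t in E, (circleKernel z t + 1) := by
    rw [integral_add (integrableOn_circleKernel hE hEf hpos fun t _ ↦ hsep t)
      (integrableOn_const hEf.ne)]
    simp [herglotzTransform]
  rw [heq]
  refine (norm_setIntegral_le_of_norm_le_const (C := 2 / (‖z‖ / 2)) hEf fun t _ ↦ ?_).trans ?_
  · have hne : Complex.exp (t * Complex.I) - z ≠ 0 := norm_pos_iff.1 (hpos.trans_le (hsep t))
    have : circleKernel z t + 1 =
        2 * Complex.exp (t * Complex.I) / (Complex.exp (t * Complex.I) - z) := by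
      rw [circleKernel]
      field_simp
      ring
    rw [this, norm_div, norm_mul, Complex.norm_exp_ofReal_mul_I, Complex.norm_two, mul_one]
    gcongr
    exact hsep t
  · calc 2 / (‖z‖ / 2) * volume.real E ≤ 2 / (‖z‖ / 2) * (2 * π) := by gcongr
      _ = 8 * π / ‖z‖ := by field_simp; ring

lemma norm_sub_div_add_conj_le_one {w u : ℂ} (hw : 0 ≤ w.re) (hu : 0 ≤ u.re) :
    ‖(w - u) / (w + conj u)‖ ≤ 1 := by
  rw [norm_div]
  refine div_le_one_of_le₀ ?_ (norm_nonneg _)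
  refine (sq_le_sq₀ (norm_nonneg _) (norm_nonneg _)).1 ?_
  rw [← Complex.normSq_eq_norm_sq, ← Complex.normSq_eq_norm_sq]
  simp only [Complex.normSq_apply, Complex.add_re, Complex.sub_re, Complex.add_im, Complex.sub_im,
    Complex.conj_re, Complex.conj_im]
  nlinarith [mul_nonneg hw hu]

/-- For `0 ≤ c < 1`, the conformal map `w ↦ exp (i c w / 4)` takes the strip `|Re w| ≤ 2π` into
the right half-plane; it is followed here by the map of the half-plane to the disc that vanishes
at the image of `-v`. -/
noncomputable def stripToDisc (c v : ℝ) (w : ℂ) : ℂ :=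
  (Complex.exp ((c / 4 : ℝ) * w * Complex.I) - Complex.exp ((-(c * v / 4) : ℝ) * Complex.I)) /
    (Complex.exp ((c / 4 : ℝ) * w * Complex.I) +
      conj (Complex.exp ((-(c * v / 4) : ℝ) * Complex.I)))

section strip

variable {c v : ℝ}

lemma re_exp_strip_nonneg (hc0 : 0 ≤ c) (hc1 : c ≤ 1) {w : ℂ} (hw : |w.re| ≤ 2 * π) :
    0 ≤ (Complex.exp ((c / 4 : ℝ) * w * Complex.I)).re := by
  rw [Complex.exp_re]
  refine mul_nonneg (exp_pos _).le (cos_nonneg_of_mem_Icc ?_)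
  rw [abs_le] at hw
  have : ((c / 4 : ℝ) * w * Complex.I).im = c / 4 * w.re := by simp
  rw [this]
  constructor <;> nlinarith [pi_pos]

lemma re_exp_center_pos (hc0 : 0 ≤ c) (hc1 : c < 1) (hv0 : 0 ≤ v) (hv : v ≤ 2 * π) :
    0 < (Complex.exp ((-(c * v / 4) : ℝ) * Complex.I)).re := by
  rw [Complex.exp_ofReal_mul_I_re, cos_neg]
  refine cos_pos_of_mem_Ioo ⟨?_, ?_⟩ <;> nlinarith [pi_pos, mul_nonneg hc0 hv0]

lemma norm_stripToDisc_le_one (hc0 : 0 ≤ c) (hc1 : c < 1) (hv0 : 0 ≤ v) (hv : v ≤ 2 * π) {w : ℂ}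
    (hw : |w.re| ≤ 2 * π) : ‖stripToDisc c v w‖ ≤ 1 :=
  norm_sub_div_add_conj_le_one (re_exp_strip_nonneg hc0 hc1.le hw)
    (re_exp_center_pos hc0 hc1 hv0 hv).le

lemma cos_le_norm_stripToDisc_denom (hc0 : 0 ≤ c) (hc1 : c ≤ 1) {w : ℂ} (hw : |w.re| ≤ 2 * π) :
    cos (c * v / 4) ≤ ‖Complex.exp ((c / 4 : ℝ) * w * Complex.I) +
      conj (Complex.exp ((-(c * v / 4) : ℝ) * Complex.I))‖ := by
  refine le_trans ?_ (Complex.re_le_norm _)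
  rw [Complex.add_re, Complex.conj_re, Complex.exp_ofReal_mul_I_re, cos_neg]
  linarith [re_exp_strip_nonneg hc0 hc1 hw]

lemma cos_center_pos (hc0 : 0 ≤ c) (hc1 : c < 1) (hv0 : 0 ≤ v) (hv : v ≤ 2 * π) :
    0 < cos (c * v / 4) := by
  simpa only [Complex.exp_ofReal_mul_I_re, cos_neg] using re_exp_center_pos hc0 hc1 hv0 hv

lemma differentiableAt_stripToDisc (hc0 : 0 ≤ c) (hc1 : c < 1) (hv0 : 0 ≤ v) (hv : v ≤ 2 * π)
    {w : ℂ} (hw : |w.re| ≤ 2 * π) : DifferentiableAt ℂ (stripToDisc c v) w := by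
  unfold stripToDisc
  refine DifferentiableAt.div (by fun_prop) (by fun_prop) ?_
  exact norm_pos_iff.1 ((cos_center_pos hc0 hc1 hv0 hv).trans_le
    (cos_le_norm_stripToDisc_denom hc0 hc1.le hw))

lemma norm_stripToDisc_self (c v : ℝ) : ‖stripToDisc c v v‖ = |sin (c * v / 4)| := by
  have h1 : ((c / 4 : ℝ) * (v : ℂ) * Complex.I) = (c * v / 4 : ℝ) * Complex.I := by
    push_cast
    ring
  rw [stripToDisc, h1]
  generalize c * v / 4 = θ
  have h2 : conj (Complex.exp ((-θ : ℝ) * Complex.I)) = Complex.exp (θ * Complex.I) := by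
    rw [← Complex.exp_conj]
    simp
  have h3 : Complex.exp (θ * Complex.I) - Complex.exp ((-θ : ℝ) * Complex.I) =
      2 * (sin θ : ℝ) * Complex.I := by
    rw [Complex.ofReal_neg, Complex.ofReal_sin, Complex.exp_mul_I,
      Complex.exp_mul_I, Complex.cos_neg, Complex.sin_neg]
    ring
  rw [h2, ← two_mul, norm_div, norm_mul, Complex.norm_exp_ofReal_mul_I, h3, norm_mul, norm_mul,
    Complex.norm_I, Complex.norm_two, Complex.norm_real, norm_eq_abs]
  ring

lemma norm_stripToDisc_le (hc0 : 0 ≤ c) (hc1 : c < 1) (hv0 : 0 ≤ v) (hv : v ≤ 2 * π) {w : ℂ}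
    (hw : |w.re| ≤ 2 * π) (hwv : ‖w + v‖ ≤ 4) :
    ‖stripToDisc c v w‖ ≤ ‖w + v‖ / cos (c * v / 4) := by
  have hu : ‖(c / 4 : ℝ) * (w + v) * Complex.I‖ ≤ ‖w + v‖ / 4 := by
    rw [norm_mul, norm_mul, Complex.norm_I, Complex.norm_real, norm_of_nonneg (by positivity)]
    nlinarith [norm_nonneg (w + v)]
  have hnum : Complex.exp ((c / 4 : ℝ) * w * Complex.I) -
      Complex.exp ((-(c * v / 4) : ℝ) * Complex.I) =
      Complex.exp ((-(c * v / 4) : ℝ) * Complex.I) *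
        (Complex.exp ((c / 4 : ℝ) * (w + v) * Complex.I) - 1) := by
    rw [mul_sub, ← Complex.exp_add, mul_one]
    congr 2
    push_cast
    ring
  rw [stripToDisc, norm_div, hnum, norm_mul, Complex.norm_exp_ofReal_mul_I, one_mul]
  have := Complex.norm_exp_sub_one_le (hu.trans (by linarith))
  exact div_le_div₀ (norm_nonneg _) (by linarith [norm_nonneg (w + v)])
    (cos_center_pos hc0 hc1 hv0 hv) (cos_le_norm_stripToDisc_denom hc0 hc1.le hw)

end strip

lemma norm_eval_le_mul_pow {Q : ℂ[X]} {N : ℕ} (hQ : Q.natDegree ≤ N) {z : ℂ} (hz : 1 ≤ ‖z‖) :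
    ‖Q.eval z‖ ≤ (∑ i ∈ Finset.range (N + 1), ‖Q.coeff i‖) * ‖z‖ ^ N := by
  rw [eval_eq_sum_range' (Nat.lt_succ_of_le hQ), Finset.sum_mul]
  refine norm_sum_le_of_le _ fun i hi ↦ ?_
  rw [norm_mul, norm_pow]
  gcongr
  exact Nat.lt_succ_iff.1 (Finset.mem_range.1 hi)

/-- A Remez-type inequality: a bound for the constant coefficient of a polynomial which is bounded
by `1` on a subset of the unit circle. -/
theorem norm_eval_zero_mul_sin_pow_le {E : Set ℝ} (hE : MeasurableSet E)
    (hE' : E ⊆ Set.Icc 0 (2 * π)) {Q : ℂ[X]} {N : ℕ} (hQ : Q.natDegree ≤ N)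
    (hQE : ∀ t ∈ E, ‖Q.eval (Complex.exp (t * Complex.I))‖ ≤ 1) {c : ℝ} (hc0 : 0 ≤ c)
    (hc1 : c < 1) :
    ‖Q.eval 0‖ * |sin (c * volume.real E / 4)| ^ (N + 1) ≤ 1 := by
  have hEf : volume E < ⊤ := (measure_mono hE').trans_lt measure_Icc_lt_top
  set v := volume.real E with hvdef
  have hv0 : 0 ≤ v := measureReal_nonneg
  have hv : v ≤ 2 * π := by
    simpa [pi_pos.le] using measureReal_mono (μ := volume) hE' measure_Icc_lt_top.ne
  have hcos := cos_center_pos hc0 hc1 hv0 hv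
  have hcont : Continuous fun z ↦ ‖Q.eval z‖ := Q.continuous.norm
  have hsep : ∀ z, 1 < ‖Q.eval z‖ →
      ∃ δ > 0, ∀ t ∈ E, δ ≤ ‖Complex.exp (t * Complex.I) - z‖ := by
    intro z hz
    obtain ⟨δ, hδ, hball⟩ := Metric.isOpen_iff.1 (isOpen_lt continuous_const hcont) z hz
    refine ⟨δ, hδ, fun t ht ↦ ?_⟩
    by_contra! hlt
    have h1 : 1 < ‖Q.eval (Complex.exp (t * Complex.I))‖ :=
      hball (by rwa [Metric.mem_ball, dist_eq_norm])
    exact (hQE t ht).not_gt h1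
  have hre : ∀ z, 1 < ‖Q.eval z‖ → |(herglotzTransform E z).re| ≤ 2 * π := fun z hz ↦ by
    obtain ⟨δ, hδ, h⟩ := hsep z hz
    exact abs_re_herglotzTransform_le hE hE' hδ h
  set G : ℂ → ℂ := fun z ↦ Q.eval z * stripToDisc c v (herglotzTransform E z) ^ (N + 1) with hG
  have hGQ : ∀ z, 1 < ‖Q.eval z‖ → ‖G z‖ ≤ ‖Q.eval z‖ := fun z hz ↦ by
    rw [hG, norm_mul, norm_pow]
    exact mul_le_of_le_one_right (norm_nonneg _)
      (pow_le_one₀ (norm_nonneg _) (norm_stripToDisc_le_one hc0 hc1 hv0 hv (hre z hz)))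
  set A := ∑ i ∈ Finset.range (N + 1), ‖Q.coeff i‖ with hA
  set B := 8 * π / cos (c * v / 4) with hB
  have hB0 : 0 < B := by positivity
  have hA0 : 0 ≤ A := Finset.sum_nonneg fun _ _ ↦ norm_nonneg _
  set R := max (2 * π) (A * B ^ (N + 1)) with hR
  have hfar : ∀ z, ‖z‖ = R → 1 < ‖Q.eval z‖ → ‖G z‖ ≤ 1 := by
    intro z hzR hz
    have hz2 : 2 * π ≤ ‖z‖ := hzR ▸ le_max_left _ _
    have hz3 : A * B ^ (N + 1) ≤ ‖z‖ := hzR ▸ le_max_right _ _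
    have hz0 : 0 < ‖z‖ := by linarith [pi_pos]
    have hF := norm_herglotzTransform_add_le hE hE' (z := z) (by linarith [pi_gt_three])
    have hF4 : ‖herglotzTransform E z + (v : ℂ)‖ ≤ 4 :=
      hF.trans (by rw [div_le_iff₀ hz0]; linarith)
    have hb : ‖stripToDisc c v (herglotzTransform E z)‖ ≤ B / ‖z‖ := by
      refine (norm_stripToDisc_le hc0 hc1 hv0 hv (hre z hz) hF4).trans ?_
      rw [hB, div_right_comm]
      gcongr
    calc ‖G z‖ ≤ A * ‖z‖ ^ N * (B / ‖z‖) ^ (N + 1) := by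
          rw [hG, norm_mul, norm_pow]
          gcongr
          exact norm_eval_le_mul_pow hQ (by linarith [pi_gt_three])
      _ = A * B ^ (N + 1) / ‖z‖ := by
          rw [div_pow, pow_succ ‖z‖]
          field_simp
      _ ≤ 1 := (div_le_one hz0).2 hz3
  have hsin : ‖G 0‖ = ‖Q.eval 0‖ * |sin (c * v / 4)| ^ (N + 1) := by
    rw [hG, norm_mul, norm_pow, herglotzTransform_zero, norm_stripToDisc_self]
  rw [← hsin]
  refine le_of_forall_pos_le_add fun ε hε ↦ ?_
  rcases le_or_gt ‖Q.eval 0‖ (1 + ε) with h0 | h0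
  · rcases le_or_gt ‖Q.eval 0‖ 1 with h1 | h1
    · rw [hsin]
      have : |sin (c * v / 4)| ^ (N + 1) ≤ 1 := pow_le_one₀ (abs_nonneg _) (abs_sin_le_one _)
      nlinarith [norm_nonneg (Q.eval 0)]
    · exact (hGQ 0 h1).trans h0
  set U : Set ℂ := Metric.ball 0 R ∩ {z | 1 + ε < ‖Q.eval z‖} with hU
  have hclQ : closure {z | 1 + ε < ‖Q.eval z‖} ⊆ {z | 1 + ε ≤ ‖Q.eval z‖} :=
    closure_lt_subset_le continuous_const hcont
  have hRpos : 0 < R := lt_max_of_lt_left (by positivity)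
  refine Complex.norm_le_of_forall_mem_frontier_norm_le (U := U) (f := G)
    (Metric.isBounded_ball.subset Set.inter_subset_left)
    (DifferentiableOn.diffContOnCl fun z hz ↦ ?_) (fun z hz ↦ ?_)
    (subset_closure ⟨Metric.mem_ball_self hRpos, h0⟩)
  · have hz1 : 1 < ‖Q.eval z‖ := by
      have : 1 + ε ≤ ‖Q.eval z‖ := hclQ (closure_mono Set.inter_subset_right hz)
      linarith
    obtain ⟨δ, hδ, h⟩ := hsep z hz1
    refine DifferentiableAt.differentiableWithinAt (Q.differentiable.differentiableAt.mul
      (DifferentiableAt.pow ?_ _))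
    exact (differentiableAt_stripToDisc hc0 hc1 hv0 hv (hre z hz1)).comp z
      (differentiableAt_herglotzTransform hE hEf hδ h)
  · rcases frontier_inter_subset _ _ hz with ⟨h1, h2⟩ | ⟨h1, h2⟩
    · have hzR : ‖z‖ = R := by
        rw [frontier_ball _ hRpos.ne'] at h1
        simpa using h1
      have : 1 + ε ≤ ‖Q.eval z‖ := hclQ h2
      linarith [hfar z hzR (by linarith)]
    · have : 1 + ε = ‖Q.eval z‖ := frontier_lt_subset_eq continuous_const hcont h2
      rw [this]
      exact hGQ z (by linarith)

/-- The homogenized Chebyshev polynomials: `u ^ m * T_m (p / u)` with `M = u ^ 2`. -/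
noncomputable def homogeneousT (p M : ℂ[X]) : ℕ → ℂ[X]
  | 0 => 1
  | 1 => p
  | m + 2 => 2 * p * homogeneousT p M (m + 1) - M * homogeneousT p M m

lemma eval_homogeneousT {p M : ℂ[X]} {z u x : ℂ} (hp : p.eval z = u * x)
    (hM : M.eval z = u ^ 2) (m : ℕ) :
    (homogeneousT p M m).eval z = u ^ m * (Chebyshev.T ℂ m).eval x := by
  induction m using Nat.twoStepInduction with
  | zero => simp [homogeneousT]
  | one => simp [homogeneousT, hp]
  | more m h0 h1 =>
    push_cast at h1 ⊢
    rw [homogeneousT, eval_sub, eval_mul, eval_mul, eval_mul, h0, h1, hp, hM, Chebyshev.T_add_two]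
    simp
    ring

lemma eval_homogeneousT_succ_of_eval_eq_zero {p M : ℂ[X]} {z : ℂ} (hM : M.eval z = 0) (m : ℕ) :
    (homogeneousT p M (m + 1)).eval z = 2 ^ m * p.eval z ^ (m + 1) := by
  induction m with
  | zero => simp [homogeneousT]
  | succ m ih =>
    rw [homogeneousT, eval_sub, eval_mul, eval_mul, eval_mul, ih, hM]
    simp
    ring

lemma natDegree_homogeneousT_le {p M : ℂ[X]} {d : ℕ} (hp : p.natDegree ≤ d)
    (hM : M.natDegree ≤ 2 * d) (m : ℕ) : (homogeneousT p M m).natDegree ≤ d * m := by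
  induction m using Nat.twoStepInduction with
  | zero => simp [homogeneousT]
  | one => simpa [homogeneousT] using hp
  | more m h0 h1 =>
    rw [homogeneousT]
    refine (natDegree_sub_le _ _).trans (max_le ?_ ?_)
    · rw [mul_assoc, show (2 : ℂ[X]) = C 2 from rfl]
      refine (natDegree_C_mul_le _ _).trans (natDegree_mul_le.trans ?_)
      linarith
    · refine natDegree_mul_le.trans ?_
      linarith

/-- The polynomial `P` with `P (e^{it}) = e^{int} f(t)`, where
`f(t) = y cos nt + ∑ k < n, (a k cos kt + b k sin kt)`. -/
noncomputable def trigToPoly (n : ℕ) (y : ℝ) (a b : ℕ → ℝ) : ℂ[X] :=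
  C (y / 2 : ℂ) * (X ^ (2 * n) + 1) + ∑ k ∈ Finset.range n,
    (C (a k / 2 : ℂ) * (X ^ (n + k) + X ^ (n - k)) +
      C (-(b k / 2) * Complex.I) * (X ^ (n + k) - X ^ (n - k)))

lemma natDegree_trigToPoly_le (n : ℕ) (y : ℝ) (a b : ℕ → ℝ) :
    (trigToPoly n y a b).natDegree ≤ 2 * n := by
  refine natDegree_add_le_of_degree_le ?_ (natDegree_sum_le_of_forall_le _ _ fun k hk ↦ ?_)
  · exact (natDegree_C_mul_le _ _).trans (by compute_degree)
  · have hk' := Finset.mem_range.1 hk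
    refine natDegree_add_le_of_degree_le ?_ ?_ <;>
      refine (natDegree_C_mul_le _ _).trans ?_
    · refine natDegree_add_le_of_degree_le ?_ ?_ <;> refine (natDegree_X_pow_le _).trans (by omega)
    · refine (natDegree_sub_le _ _).trans (max_le ?_ ?_) <;>
        refine (natDegree_X_pow_le _).trans (by omega)

lemma eval_zero_trigToPoly {n : ℕ} (hn : 1 ≤ n) (y : ℝ) (a b : ℕ → ℝ) :
    (trigToPoly n y a b).eval 0 = y / 2 := by
  rw [trigToPoly, eval_add, eval_finsetSum, Finset.sum_eq_zero]
  · simp [show n ≠ 0 by omega]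
  · intro k hk
    have hk' := Finset.mem_range.1 hk
    simp [show n ≠ 0 by omega, show n - k ≠ 0 by omega]

lemma eval_exp_trigToPoly (n : ℕ) (y : ℝ) (a b : ℕ → ℝ) (t : ℝ) :
    (trigToPoly n y a b).eval (Complex.exp (t * Complex.I)) =
      Complex.exp (t * Complex.I) ^ n * ((y * cos (n * t) +
        ∑ k ∈ Finset.range n, (a k * cos (k * t) + b k * sin (k * t)) : ℝ) : ℂ) := by
  set e := Complex.exp (t * Complex.I) with he
  have he0 : e ≠ 0 := Complex.exp_ne_zero _
  have hexp : ∀ k : ℕ, Complex.exp (k * t * Complex.I) = e ^ k := fun k ↦ by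
    rw [he, ← Complex.exp_nat_mul, mul_assoc]
  have hexpn : ∀ k : ℕ, Complex.exp (-(k * t) * Complex.I) = (e ^ k)⁻¹ := fun k ↦ by
    rw [neg_mul, Complex.exp_neg, hexp]
  have hcos : ∀ k : ℕ, Complex.cos (k * t) = (e ^ k + (e ^ k)⁻¹) / 2 := fun k ↦ by
    rw [Complex.cos, hexp, hexpn]
  have hsin : ∀ k : ℕ, Complex.sin (k * t) = ((e ^ k)⁻¹ - e ^ k) * Complex.I / 2 := fun k ↦ by
    rw [Complex.sin, hexp, hexpn]
  rw [trigToPoly, eval_add, eval_finsetSum]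
  push_cast
  rw [mul_add (e ^ n), Finset.mul_sum]
  congr 1
  · rw [hcos]
    simp only [eval_mul, eval_C, eval_add, eval_pow, eval_X, eval_one]
    field_simp
    ring
  · refine Finset.sum_congr rfl fun k hk ↦ ?_
    have hk' := Finset.mem_range.1 hk
    have hsub : e ^ (n - k) = e ^ n * (e ^ k)⁻¹ := pow_sub₀ e he0 hk'.le
    rw [hcos, hsin]
    simp only [eval_mul, eval_C, eval_add, eval_sub, eval_pow, eval_X, hsub, pow_add]
    ring

lemma le_one_of_forall_pow_le {x K : ℝ} (h : ∀ m : ℕ, x ^ m ≤ K) : x ≤ 1 := by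
  by_contra! hx
  obtain ⟨m, hm⟩ := pow_unbounded_of_one_lt K hx
  exact (h m).not_gt hm

/-- The sharp Remez-type bound for the leading coefficient of a trigonometric polynomial which is
bounded by `1` on `E`. -/
theorem mul_sin_pow_le_one {n : ℕ} (hn : 1 ≤ n) {y : ℝ} (hy : 0 ≤ y) (a b : ℕ → ℝ) {E : Set ℝ}
    (hE : MeasurableSet E) (hE' : E ⊆ Set.Icc 0 (2 * π))
    (hf : ∀ t ∈ E, |y * cos (n * t) +
      ∑ k ∈ Finset.range n, (a k * cos (k * t) + b k * sin (k * t))| ≤ 1) :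
    y * |sin (volume.real E / 4)| ^ (2 * n) ≤ 1 := by
  have key : ∀ c : ℝ, 0 ≤ c → c < 1 → y * |sin (c * volume.real E / 4)| ^ (2 * n) ≤ 1 := by
    intro c hc0 hc1
    set s := |sin (c * volume.real E / 4)| with hs
    have hs0 : 0 ≤ s := abs_nonneg _
    rcases hs0.eq_or_lt with h0 | h0
    · rw [← h0, zero_pow (by omega)]
      simp
    refine le_one_of_forall_pow_le (K := max 1 (2 / s)) fun m ↦ ?_
    rcases m with _ | m
    · simp
    refine le_max_of_le_right ?_
    rw [le_div_iff₀ h0]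
    have hbound := norm_eval_zero_mul_sin_pow_le hE hE'
      (natDegree_homogeneousT_le (natDegree_trigToPoly_le n y a b)
        (M := X ^ (2 * n)) (by rw [natDegree_X_pow]; omega) (m + 1)) (fun t ht ↦ ?_) hc0 hc1
    · rw [eval_homogeneousT_succ_of_eval_eq_zero (by simp [show n ≠ 0 by omega]),
        eval_zero_trigToPoly hn] at hbound
      have hnorm : ‖(2 : ℂ) ^ m * (y / 2 : ℂ) ^ (m + 1)‖ = y ^ (m + 1) / 2 := by
        rw [norm_mul, norm_pow, norm_pow, norm_div, Complex.norm_two, Complex.norm_real,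
          norm_of_nonneg hy, div_pow, pow_succ (2 : ℝ)]
        field_simp
      rw [hnorm, ← hs, pow_succ s, pow_mul] at hbound
      rw [mul_pow]
      linarith
    · rw [eval_homogeneousT (eval_exp_trigToPoly n y a b t) (by simp [← pow_mul, mul_comm]),
        ← Chebyshev.complex_ofReal_eval_T, norm_mul, norm_pow, norm_pow,
        Complex.norm_exp_ofReal_mul_I, one_pow, one_pow, one_mul, Complex.norm_real]
      exact Chebyshev.abs_eval_T_real_le_one _ (hf t ht)
  have hcont : Continuous fun c : ℝ ↦ y * |sin (c * volume.real E / 4)| ^ (2 * n) := by fun_prop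
  have hlim := (hcont.tendsto 1).mono_left (nhdsWithin_le_nhds (s := Set.Iio 1))
  rw [one_mul] at hlim
  refine le_of_tendsto hlim ?_
  filter_upwards [Ioo_mem_nhdsLT (show (0 : ℝ) < 1 by norm_num)] with c hc
  exact key c hc.1.le hc.2

lemma rpow_neg_one_div_mem_Icc {y : ℝ} (hy : 1 < y) (n : ℕ) :
    y ^ (-(1 : ℝ) / (2 * n)) ∈ Set.Icc 0 1 := by
  refine ⟨by positivity, rpow_le_one_of_one_le_of_nonpos hy.le ?_⟩
  rw [neg_div]
  exact neg_nonpos.2 (by positivity)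

theorem ofReal_arccos_le_volume {n : ℕ} (hn : 1 ≤ n) {y : ℝ} (hy : 1 < y) (a b : ℕ → ℝ) :
    ENNReal.ofReal (4 * arccos (y ^ (-(1 : ℝ) / (2 * n)))) ≤
      volume {t : ℝ | t ∈ Set.Ico 0 (2 * π) ∧ 1 ≤ |y * cos (n * t) +
        ∑ k ∈ Finset.range n, (a k * cos (k * t) + b k * sin (k * t))|} := by
  set f : ℝ → ℝ := fun t ↦ y * cos (n * t) +
    ∑ k ∈ Finset.range n, (a k * cos (k * t) + b k * sin (k * t)) with hf
  have hfc : Continuous f := by fun_prop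
  set E : Set ℝ := Set.Ico 0 (2 * π) ∩ {t | |f t| < 1} with hEdef
  have hE : MeasurableSet E :=
    measurableSet_Ico.inter (isOpen_lt hfc.abs continuous_const).measurableSet
  have hEI : E ⊆ Set.Ico 0 (2 * π) := Set.inter_subset_left
  have hdiff : {t : ℝ | t ∈ Set.Ico 0 (2 * π) ∧ 1 ≤ |f t|} = Set.Ico 0 (2 * π) \ E := by
    ext t
    simp only [hEdef, Set.mem_ofPred_eq, Set.mem_sdiff, Set.mem_inter_iff, ← not_lt]
    tauto
  have hEf : volume E ≠ ⊤ := ((measure_mono hEI).trans_lt measure_Ico_lt_top).ne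
  have hv : volume.real E ≤ 2 * π := by
    simpa [pi_pos.le] using measureReal_mono (μ := volume) hEI measure_Ico_lt_top.ne
  have hv0 : 0 ≤ volume.real E := measureReal_nonneg
  have hmain := mul_sin_pow_le_one hn (zero_le_one.trans hy.le) a b hE
    (hEI.trans Set.Ico_subset_Icc_self) fun t ht ↦ ht.2.le
  obtain ⟨hr0, hr1⟩ := rpow_neg_one_div_mem_Icc hy n
  have hpow : (y ^ (-(1 : ℝ) / (2 * n))) ^ (2 * n) = y⁻¹ := by
    rw [← rpow_natCast, ← rpow_mul (by positivity), ← rpow_neg_one]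
    congr 1
    push_cast
    field_simp
  have hsin : sin (volume.real E / 4) ≤ y ^ (-(1 : ℝ) / (2 * n)) := by
    refine (le_abs_self _).trans (le_of_pow_le_pow_left₀ (n := 2 * n) (by omega) hr0 ?_)
    rw [hpow, ← one_div, le_div_iff₀ (by positivity)]
    linarith
  have harc : volume.real E / 4 ≤ arcsin (y ^ (-(1 : ℝ) / (2 * n))) :=
    (le_arcsin_iff_sin_le ⟨by linarith [pi_pos], by linarith⟩ ⟨by linarith, hr1⟩).2 hsin
  rw [hdiff, measure_sdiff hEI hE.nullMeasurableSet hEf, Real.volume_Ico,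
    ← ofReal_measureReal hEf, ← ENNReal.ofReal_sub _ hv0, arccos]
  exact ENNReal.ofReal_le_ofReal (by linarith)

lemma countable_setOf_cos_eq (x : ℝ) : {t : ℝ | cos t = x}.Countable := by
  rcases Set.eq_empty_or_nonempty {t : ℝ | cos t = x} with h | ⟨s, rfl⟩
  · simp [h]
  · refine ((Set.countable_range fun k : ℤ ↦ 2 * k * π + s).union
      (Set.countable_range fun k : ℤ ↦ 2 * k * π - s)).mono fun t ht ↦ ?_
    obtain ⟨k, hk | hk⟩ := cos_eq_cos_iff.1 (Eq.symm ht)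
    · exact Or.inl ⟨k, hk.symm⟩
    · exact Or.inr ⟨k, hk.symm⟩

theorem volume_chebyshev_eq {n : ℕ} (hn : 1 ≤ n) {y : ℝ} (hy : 1 < y) :
    volume {t : ℝ | t ∈ Set.Ico 0 (2 * π) ∧
        1 ≤ |(Chebyshev.T ℝ n).eval (y ^ ((1 : ℝ) / n) * cos t - y ^ ((1 : ℝ) / n) + 1)|}
      = ENNReal.ofReal (4 * arccos (y ^ (-(1 : ℝ) / (2 * n)))) := by
  obtain ⟨hr0, hr1⟩ := rpow_neg_one_div_mem_Icc hy n
  set c := y ^ ((1 : ℝ) / n) with hc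
  set r := y ^ (-(1 : ℝ) / (2 * n)) with hr
  have hc0 : 0 < c := by positivity
  have hrpos : 0 < r := by positivity
  have hcr : c * r ^ 2 = 1 := by
    rw [hc, hr, ← rpow_natCast, ← rpow_mul (by positivity), ← rpow_add (by positivity)]
    have : (1 : ℝ) / n + -1 / (2 * n) * (2 : ℕ) = 0 := by
      push_cast
      field_simp
      ring
    rw [this, rpow_zero]
  have hx : ∀ t, c * cos t - c + 1 = 1 - 2 * c * sin (t / 2) ^ 2 := fun t ↦ by
    have h1 := cos_sq' (t / 2)
    have h2 := cos_two_mul (t / 2)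
    rw [mul_div_cancel₀ t two_ne_zero] at h2
    rw [h2, h1]
    ring
  have ha0 : 0 ≤ arcsin r := arcsin_nonneg.2 hr0
  have ha1 : arcsin r ≤ π / 2 := arcsin_le_pi_div_two r
  have hsin_arcsin : sin (arcsin r) = r := sin_arcsin (by linarith) hr1
  have hle : ∀ t, c * cos t - c + 1 ≤ 1 := fun t ↦ by
    rw [hx]
    have : 0 ≤ 2 * c * sin (t / 2) ^ 2 := by positivity
    linarith
  have hlow : ∀ t, r ≤ sin (t / 2) → c * cos t - c + 1 ≤ -1 := fun t ht ↦ by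
    rw [hx]
    have : r ^ 2 ≤ sin (t / 2) ^ 2 := by gcongr
    nlinarith
  have hhigh : ∀ t, 0 ≤ sin (t / 2) → sin (t / 2) ≤ r → -1 ≤ c * cos t - c + 1 :=
    fun t h0 ht ↦ by
      rw [hx]
      have : sin (t / 2) ^ 2 ≤ r ^ 2 := by gcongr
      nlinarith
  set S := {t : ℝ | t ∈ Set.Ico 0 (2 * π) ∧ 1 ≤ |(Chebyshev.T ℝ n).eval (c * cos t - c + 1)|}
  set A := Set.Ico (2 * arcsin r) (2 * π - 2 * arcsin r) with hA
  have hAS : A ⊆ S := fun t ⟨h1, h2⟩ ↦ by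
    refine ⟨⟨by linarith, by linarith⟩, Chebyshev.one_le_abs_eval_T_real _ ?_⟩
    refine le_abs.2 (Or.inr ?_)
    have : r ≤ sin (t / 2) := by
      rw [← hsin_arcsin]
      rcases le_total (t / 2) (π / 2) with h | h
      · exact sin_le_sin_of_le_of_le_pi_div_two (by linarith) h (by linarith)
      · rw [← sin_pi_sub (t / 2)]
        exact sin_le_sin_of_le_of_le_pi_div_two (by linarith) (by linarith) (by linarith)
    linarith [hlow t this]
  have hN : (S \ A).Countable := by
    refine (Set.countable_iUnion fun k : ℕ ↦
      countable_setOf_cos_eq ((cos (k * π / n) + c - 1) / c)).mono ?_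
    rintro t ⟨⟨⟨h1, h2⟩, h3⟩, h4⟩
    have hs0 : 0 ≤ sin (t / 2) := sin_nonneg_of_nonneg_of_le_pi (by linarith) (by linarith)
    have hsr : sin (t / 2) ≤ r := by
      rw [← hsin_arcsin]
      rcases lt_or_ge t (2 * arcsin r) with h | h
      · exact sin_le_sin_of_le_of_le_pi_div_two (by linarith) ha1 (by linarith)
      · have h5 : 2 * π - 2 * arcsin r ≤ t := not_lt.1 fun h5 ↦ h4 ⟨h, h5⟩
        rw [← sin_pi_sub (t / 2)]
        exact sin_le_sin_of_le_of_le_pi_div_two (by linarith) ha1 (by linarith)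
    have habs : |c * cos t - c + 1| ≤ 1 := abs_le.2 ⟨hhigh t hs0 hsr, hle t⟩
    have h1' := (Chebyshev.abs_eval_T_real_le_one n habs).antisymm h3
    obtain ⟨k, -, hk⟩ := (Chebyshev.abs_eval_T_real_eq_one_iff (by omega) _).1 h1'
    refine Set.mem_iUnion.2 ⟨k, ?_⟩
    rw [Set.mem_ofPred_eq, ← hk]
    field_simp
    ring
  have hvol : volume S = volume A := by
    refine le_antisymm ?_ (measure_mono hAS)
    calc volume S ≤ volume (A ∪ S \ A) := by
          rw [Set.union_sdiff_self]
          exact measure_mono Set.subset_union_right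
      _ ≤ volume A + volume (S \ A) := measure_union_le _ _
      _ = volume A := by rw [hN.measure_zero, add_zero]
  rw [hvol, hA, Real.volume_Ico, arccos]
  congr 1
  ring

theorem stmt_14 (n : ℕ) (hn : 1 ≤ n) (y : ℝ) (hy : 1 < y) :
    (∀ a b : ℕ → ℝ,
      ENNReal.ofReal (4 * Real.arccos (y ^ (-(1 : ℝ) / (2 * n)))) ≤
        volume {t : ℝ | t ∈ Set.Ico 0 (2 * Real.pi) ∧
          1 ≤ |y * Real.cos (n * t) +
            ∑ k ∈ Finset.range n, (a k * Real.cos (k * t) + b k * Real.sin (k * t))|}) ∧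
    volume {t : ℝ | t ∈ Set.Ico 0 (2 * Real.pi) ∧
        1 ≤ |(Polynomial.Chebyshev.T ℝ n).eval
          (y ^ ((1 : ℝ) / n) * Real.cos t - y ^ ((1 : ℝ) / n) + 1)|}
      = ENNReal.ofReal (4 * Real.arccos (y ^ (-(1 : ℝ) / (2 * n)))) :=
  ⟨ofReal_arccos_le_volume hn hy, volume_chebyshev_eq hn hy⟩
end

section
/- For m ≥ 1 and 0 < h < 2, define δ_m(h) as the infimum over all monic degree-m polynomials P with all zeros on the unit circle of the Lebesgue measure of { t ∈ [0, 2π) : |P(e^{it})| ≥ h }. Then δ_m(h) = 4 arccos( (h/2)^{1/m} ). -/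
open Real MeasureTheory
open Polynomial ComplexConjugate

theorem norm_pow_sub_pow_le_of_norm_le_one {x y : ℂ} (hx : ‖x‖ ≤ 1) (hy : ‖y‖ ≤ 1) (n : ℕ) :
    ‖x ^ n - y ^ n‖ ≤ n * ‖x - y‖ := by
  induction n with
  | zero => simp
  | succ n ih =>
    have e : x ^ (n + 1) - y ^ (n + 1) = x ^ n * (x - y) + (x ^ n - y ^ n) * y := by ring
    have h1 : ‖x ^ n * (x - y)‖ ≤ ‖x - y‖ := by
      rw [norm_mul, norm_pow]
      exact mul_le_of_le_one_left (norm_nonneg _) (pow_le_one₀ (norm_nonneg _) hx)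
    have h2 : ‖(x ^ n - y ^ n) * y‖ ≤ n * ‖x - y‖ := by
      rw [norm_mul]
      exact (mul_le_of_le_one_right (norm_nonneg _) hy).trans ih
    rw [e]
    push_cast
    linarith [norm_add_le (x ^ n * (x - y)) ((x ^ n - y ^ n) * y)]

theorem add_ne_zero_of_re_pos {c w : ℂ} (hc : 0 < c.re) (hw : 0 ≤ w.re) : w + c ≠ 0 := fun h => by
  have := congrArg Complex.re h
  simp only [Complex.add_re, Complex.zero_re] at this
  linarith

theorem norm_sub_conj_div_add_le_one {c w : ℂ} (hc : 0 < c.re) (hw : 0 ≤ w.re) :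
    ‖(w - conj c) / (w + c)‖ ≤ 1 := by
  rw [norm_div, div_le_one (norm_pos_iff.2 (add_ne_zero_of_re_pos hc hw))]
  refine abs_le_of_sq_le_sq' ?_ (norm_nonneg _) |>.2
  rw [Complex.sq_norm, Complex.sq_norm, Complex.normSq_apply, Complex.normSq_apply]
  simp
  nlinarith [mul_nonneg hc.le hw]

theorem norm_halfPlaneMap_sub_conj_le {c w : ℂ} (hc : 0 < c.re) (hw : 0 < w.re) :
    ‖(w - conj c) / (w + c) - (conj w - conj c) / (conj w + c)‖ ≤ |w.im| / w.re := by
  have h1 : w + c ≠ 0 := add_ne_zero_of_re_pos hc hw.le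
  have h2 : conj w + c ≠ 0 := add_ne_zero_of_re_pos hc (by simpa using hw.le)
  have e : (w - conj c) / (w + c) - (conj w - conj c) / (conj w + c)
      = ((w - conj w) * (c + conj c)) / ((w + c) * (conj w + c)) := by
    field_simp
    ring
  rw [e, Complex.sub_conj, Complex.add_conj, norm_div, norm_mul, norm_mul (w + c),
    div_le_div_iff₀ (by positivity) hw]
  have n1 : w.re + c.re ≤ ‖w + c‖ := by simpa using Complex.re_le_norm (w + c)
  have n2 : w.re + c.re ≤ ‖conj w + c‖ := by simpa using Complex.re_le_norm (conj w + c)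
  have n3 : (w.re + c.re) * (w.re + c.re) ≤ ‖w + c‖ * ‖conj w + c‖ := by gcongr
  have e2 : ‖((2 * w.im : ℝ) : ℂ) * Complex.I‖ = 2 * |w.im| := by
    simp
  have e3 : ‖((2 * c.re : ℝ) : ℂ)‖ = 2 * c.re := by
    rw [Complex.norm_real, Real.norm_eq_abs, abs_of_pos (by positivity)]
  rw [e2, e3]
  have : 2 * (2 * c.re) * w.re ≤ ‖w + c‖ * ‖conj w + c‖ := by
    nlinarith [sq_nonneg (w.re - c.re)]
  nlinarith [mul_le_mul_of_nonneg_left this (abs_nonneg w.im)]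

theorem re_eval_mem_Icc_of_norm_le_one {A : ℂ[X]} {r s : ℝ}
    (hr : ∀ z : ℂ, ‖z‖ = 1 → r ≤ (A.eval z).re) (hs : ∀ z : ℂ, ‖z‖ = 1 → (A.eval z).re ≤ s)
    {z : ℂ} (hz : ‖z‖ ≤ 1) : r ≤ (A.eval z).re ∧ (A.eval z).re ≤ s := by
  have key : ∀ (B : ℂ[X]) (u : ℝ), (∀ z : ℂ, ‖z‖ = 1 → (B.eval z).re ≤ u) →
      (B.eval z).re ≤ u := by
    intro B u hB
    have hd : Differentiable ℂ fun z => Complex.exp (B.eval z) := by fun_prop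
    have := Complex.norm_le_of_forall_mem_frontier_norm_le (U := Metric.ball 0 1) (z := z)
      (C := Real.exp u) Metric.isBounded_ball hd.diffContOnCl (by
        intro w hw
        rw [frontier_ball _ one_ne_zero] at hw
        simp only [Complex.norm_exp, Real.exp_le_exp]
        exact hB w (by simpa using hw)) (by
        rw [closure_ball _ one_ne_zero]; simpa using hz)
    simpa only [Complex.norm_exp, Real.exp_le_exp] using this
  refine ⟨?_, key A s hs⟩
  have := key (-A) (-r) (by simpa using hr)
  simpa using this

theorem circleAverage_conj (f : ℂ → ℂ) :
    circleAverage (fun z => conj (f z)) 0 1 = conj (circleAverage f 0 1) := by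
  simp only [circleAverage, intervalIntegral.integral_of_le two_pi_pos.le, integral_conj,
    Complex.real_smul, map_mul, Complex.conj_ofReal]

theorem circleAverage_eval_mul_conj_pow_eq_zero {C : ℂ → ℂ}
    (hC : DifferentiableOn ℂ C (Metric.closedBall 0 1)) (hC0 : C 0 = 0) {Q : ℂ[X]} {d : ℕ}
    (hQ : Q.natDegree ≤ d) :
    circleAverage (fun z => Q.eval z * conj (C z) ^ (d + 1)) 0 1 = 0 := by
  have hnhds : Metric.closedBall (0 : ℂ) 1 ∈ nhds (0 : ℂ) := Metric.closedBall_mem_nhds _ one_pos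
  set R : ℂ[X] := (Q.map (starRingEnd ℂ)).reflect d with hR
  have hd : DifferentiableOn ℂ (dslope C 0) (Metric.closedBall 0 1) :=
    (Complex.differentiableOn_dslope hnhds).2 hC
  have h0 : circleAverage (fun z => z * R.eval z * dslope C 0 z ^ (d + 1)) 0 1 = 0 := by
    have hdd : DifferentiableOn ℂ (fun z => z * R.eval z * dslope C 0 z ^ (d + 1))
        (Metric.closedBall 0 1) := by
      refine ((differentiableOn_id).mul ?_).mul (hd.pow _)
      exact R.differentiable.differentiableOn
    have := DiffContOnCl.circleAverage (f := fun z => z * R.eval z * dslope C 0 z ^ (d + 1))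
      (c := 0) (R := 1) (by
        rw [abs_one]
        exact DifferentiableOn.diffContOnCl (by rwa [closure_ball _ one_ne_zero]))
    simpa using this
  have e : Set.EqOn (fun z => Q.eval z * conj (C z) ^ (d + 1))
      (fun z => conj (z * R.eval z * dslope C 0 z ^ (d + 1))) (Metric.sphere 0 |1|) := by
    intro z hz
    have hz1 : ‖z‖ = 1 := by simpa using hz
    have hz0 : z ≠ 0 := by
      rintro rfl
      simp at hz1
    have hzz : z * conj z = 1 := by rw [Complex.mul_conj, Complex.normSq_eq_norm_sq, hz1]; simp
    have hCz : C z = z * dslope C 0 z := by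
      rw [dslope_of_ne _ hz0, slope_def_field, hC0]
      field_simp
      rw [sub_zero, sub_zero, mul_comm]
    have hRz : R.eval z = conj (Q.eval z) * z ^ d := by
      let _ : Invertible (conj z) := ⟨z, hzz, by rw [mul_comm]; exact hzz⟩
      have h1 : R.eval z * conj z ^ d = (Q.map (starRingEnd ℂ)).eval (conj z) :=
        eval₂_reflect_mul_pow (RingHom.id ℂ) (conj z) d (Q.map (starRingEnd ℂ))
          ((natDegree_map_le).trans hQ)
      have h2 : (Q.map (starRingEnd ℂ)).eval (conj z) = conj (Q.eval z) := by
        rw [eval_map, eval₂_hom]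
      rw [← h2, ← h1, mul_assoc, ← mul_pow, mul_comm (conj z), hzz, one_pow, mul_one]
    simp only [hCz, hRz, map_mul, map_pow, Complex.conj_conj, mul_pow]
    ring
  rw [circleAverage_congr_sphere e, circleAverage_conj, h0, map_zero]

theorem norm_circleAverage_le {f : ℂ → ℂ} {K : ℝ} (hf : ∀ z : ℂ, ‖z‖ = 1 → ‖f z‖ ≤ K) :
    ‖circleAverage f 0 1‖ ≤ K := by
  have := intervalIntegral.norm_integral_le_of_norm_le_const (a := 0) (b := 2 * π)
    (f := fun θ => f (circleMap 0 1 θ)) (C := K) (fun θ _ => hf _ (by simp))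
  rw [sub_zero, abs_of_pos two_pi_pos] at this
  rw [circleAverage, norm_smul, norm_inv, Real.norm_eq_abs, abs_of_pos two_pi_pos,
    inv_mul_le_iff₀ two_pi_pos]
  linarith

theorem norm_eval_zero_mul_sin_pow_le_s15 {A Q : ℂ[X]} {d : ℕ} {r M N η : ℝ} (hQ : Q.natDegree ≤ d)
    (hr : r < 1) (hA0 : ∀ z : ℂ, ‖z‖ = 1 → 0 ≤ (A.eval z).re)
    (hA1 : ∀ z : ℂ, ‖z‖ = 1 → (A.eval z).re ≤ r) (him : (A.eval 0).im = 0)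
    (hη0 : 0 ≤ η) (hη1 : η < 1) (hM : 0 ≤ M) (hN : ∀ z : ℂ, ‖z‖ = 1 → ‖Q.eval z‖ ≤ N)
    (hE : ∀ z : ℂ, ‖z‖ = 1 → ‖Q.eval z‖ ≤ M ∨ (A.eval z).re ≤ η) :
    ‖Q.eval 0‖ * Real.sin (π / 2 * (A.eval 0).re) ^ (d + 1)
      ≤ 2 * M + N * ((d + 1) * Real.tan (π / 2 * η)) := by
  have hpi := pi_pos
  have hdisc : ∀ z : ℂ, ‖z‖ ≤ 1 → 0 ≤ (A.eval z).re ∧ (A.eval z).re ≤ r :=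
    fun z hz => re_eval_mem_Icc_of_norm_le_one hA0 hA1 hz
  set a : ℝ := π / 2 * (A.eval 0).re with ha
  obtain ⟨a0, a1⟩ := hdisc 0 (by simp)
  have ha0 : 0 ≤ a := by positivity
  have ha1 : a < π / 2 := by
    rw [ha]
    nlinarith
  set F : ℂ → ℂ := fun z => Complex.exp ((π / 2 : ℝ) * Complex.I * A.eval z) with hF
  have hFre : ∀ z, (F z).re = Real.exp (-(π / 2 * (A.eval z).im)) *
      Real.cos (π / 2 * (A.eval z).re) := by
    intro z
    simp only [hF, Complex.exp_re]
    congr 2 <;> simp [Complex.mul_re, Complex.mul_im]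
  have hFim : ∀ z, (F z).im = Real.exp (-(π / 2 * (A.eval z).im)) *
      Real.sin (π / 2 * (A.eval z).re) := by
    intro z
    simp only [hF, Complex.exp_im]
    congr 2 <;> simp [Complex.mul_re, Complex.mul_im]
  have hFpos : ∀ z : ℂ, ‖z‖ ≤ 1 → 0 < (F z).re := by
    intro z hz
    obtain ⟨h0, h1⟩ := hdisc z hz
    rw [hFre]
    refine mul_pos (Real.exp_pos _) (Real.cos_pos_of_mem_Ioo ⟨by nlinarith, by nlinarith⟩)
  have hFd : Differentiable ℂ F := by
    simp only [hF]
    fun_prop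
  set c : ℂ := F 0 with hc
  have hcre : 0 < c.re := hFpos 0 (by simp)
  have hcn : ‖c‖ = 1 := by
    simp only [hc, hF, Complex.norm_exp]
    simp [him]
  have hcim : c.im = Real.sin a := by
    rw [hc, hFim, him]
    simp [ha]
  have hcre' : 0 < (conj c).re := by simpa using hcre
  set B : ℂ → ℂ := fun z => (F z - conj c) / (F z + c) with hB
  set C : ℂ → ℂ := fun z => (F z - c) / (F z + conj c) with hC
  have hBd : DifferentiableOn ℂ B (Metric.closedBall 0 1) := by
    refine (hFd.differentiableOn.sub_const _).div (hFd.differentiableOn.add_const _) ?_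
    intro z hz
    exact add_ne_zero_of_re_pos hcre (hFpos z (by simpa using hz)).le
  have hCd : DifferentiableOn ℂ C (Metric.closedBall 0 1) := by
    refine (hFd.differentiableOn.sub_const _).div (hFd.differentiableOn.add_const _) ?_
    intro z hz
    exact add_ne_zero_of_re_pos hcre' (hFpos z (by simpa using hz)).le
  have hB0 : ‖B 0‖ = Real.sin a := by
    simp only [hB, ← hc]
    rw [Complex.sub_conj, norm_div, ← two_mul, norm_mul, norm_mul, hcn, hcim]
    simp [-Complex.ofReal_sin, abs_of_nonneg (sin_nonneg_of_nonneg_of_le_pi ha0 (by linarith))]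
  have hsub : Metric.sphere (0 : ℂ) |1| ⊆ Metric.closedBall 0 1 := by
    rw [abs_one]
    exact Metric.sphere_subset_closedBall
  have avgB : circleAverage (fun z => Q.eval z * B z ^ (d + 1)) 0 1
      = Q.eval 0 * B 0 ^ (d + 1) := by
    refine DiffContOnCl.circleAverage (f := fun z => Q.eval z * B z ^ (d + 1)) ?_
    rw [abs_one]
    refine DifferentiableOn.diffContOnCl ?_
    rw [closure_ball _ one_ne_zero]
    exact Q.differentiable.differentiableOn.mul (hBd.pow _)
  have avgC : circleAverage (fun z => Q.eval z * conj (C z) ^ (d + 1)) 0 1 = 0 :=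
    circleAverage_eval_mul_conj_pow_eq_zero hCd (by simp [hC, hc]) hQ
  have avg : circleAverage (fun z => Q.eval z * B z ^ (d + 1) - Q.eval z * conj (C z) ^ (d + 1)) 0 1
      = Q.eval 0 * B 0 ^ (d + 1) := by
    rw [circleAverage_fun_sub, avgB, avgC, sub_zero]
    · refine ContinuousOn.circleIntegrable' ?_
      exact Q.continuous.continuousOn.mul ((hBd.continuousOn.mono hsub).pow _)
    · refine ContinuousOn.circleIntegrable' ?_
      refine Q.continuous.continuousOn.mul (ContinuousOn.pow ?_ _)
      exact Complex.continuous_conj.comp_continuousOn (hCd.continuousOn.mono hsub)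
  have hbd : ‖Q.eval 0 * B 0 ^ (d + 1)‖ ≤ 2 * M + N * ((d + 1) * Real.tan (π / 2 * η)) := by
    rw [← avg]
    refine norm_circleAverage_le fun z hz => ?_
    have hN0 : 0 ≤ N := (norm_nonneg _).trans (hN z hz)
    have hFz := hFpos z hz.le
    have htan : 0 ≤ Real.tan (π / 2 * η) :=
      tan_nonneg_of_nonneg_of_le_pi_div_two (by positivity) (by nlinarith)
    have hconj : conj (C z) = (conj (F z) - conj c) / (conj (F z) + c) := by simp [hC]
    have nB : ‖B z‖ ≤ 1 := norm_sub_conj_div_add_le_one hcre hFz.le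
    have nC : ‖conj (C z)‖ ≤ 1 := by
      rw [hconj]
      exact norm_sub_conj_div_add_le_one hcre (by simpa using hFz.le)
    rw [← mul_sub, norm_mul]
    rcases hE z hz with h | h
    · have h2 : ‖B z ^ (d + 1) - conj (C z) ^ (d + 1)‖ ≤ 2 := by
        refine (norm_sub_le _ _).trans ?_
        rw [norm_pow, norm_pow]
        linarith [pow_le_one₀ (n := d + 1) (norm_nonneg _) nB,
          pow_le_one₀ (n := d + 1) (norm_nonneg _) nC]
      have h3 : 0 ≤ N * ((d + 1) * Real.tan (π / 2 * η)) := by positivity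
      have := mul_le_mul h h2 (norm_nonneg _) hM
      linarith
    · have h2 := norm_pow_sub_pow_le_of_norm_le_one nB nC (d + 1)
      have h3 : ‖B z - conj (C z)‖ ≤ Real.tan (π / 2 * η) := by
        rw [hconj]
        refine (norm_halfPlaneMap_sub_conj_le hcre hFz).trans ?_
        obtain ⟨h0, h1⟩ := hdisc z hz.le
        rw [hFre, hFim, abs_mul, abs_of_pos (Real.exp_pos _),
          mul_div_mul_left _ _ (Real.exp_pos _).ne',
          abs_of_nonneg (sin_nonneg_of_nonneg_of_le_pi (by positivity) (by nlinarith)),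
          ← Real.tan_eq_sin_div_cos]
        exact Real.strictMonoOn_tan.monotoneOn ⟨by nlinarith, by nlinarith⟩
          ⟨by nlinarith, by nlinarith⟩ (by gcongr)
      have h4 : ‖B z ^ (d + 1) - conj (C z) ^ (d + 1)‖ ≤ (d + 1) * Real.tan (π / 2 * η) := by
        refine h2.trans ?_
        push_cast
        gcongr
      have := mul_le_mul (hN z hz) h4 (norm_nonneg _) hN0
      linarith
  rwa [norm_mul, norm_pow, hB0] at hbd

theorem exists_polynomial_re_eval_near {g : ℂ → ℝ} (hg : Continuous g) {ε : ℝ} (hε : 0 < ε) :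
    ∃ A : ℂ[X], ∀ z : ℂ, ‖z‖ = 1 → |(A.eval z).re - g z| < ε := by
  have : Fact (0 < 2 * π) := ⟨two_pi_pos⟩
  let G : C(AddCircle (2 * π), ℂ) :=
    ⟨fun x => (g (AddCircle.toCircle x : ℂ) : ℂ), by
      have := AddCircle.continuous_toCircle (T := 2 * π)
      fun_prop⟩
  have hG : G ∈ (Submodule.span ℂ (Set.range <| @fourier (2 * π))).topologicalClosure := by
    rw [span_fourier_closure_eq_top]
    trivial
  obtain ⟨p, hp, hpG⟩ := Metric.mem_closure_iff.1 hG ε hε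
  have hA : ∃ A : ℂ[X], ∀ x : AddCircle (2 * π),
      (A.eval (AddCircle.toCircle x : ℂ)).re = (p x).re := by
    have hmono : ∀ (k : ℤ) (c : ℂ), ∃ A : ℂ[X], ∀ x : AddCircle (2 * π),
        (A.eval (AddCircle.toCircle x : ℂ)).re = (c * fourier k x).re := by
      intro k c
      obtain ⟨n, rfl | rfl⟩ := k.eq_nat_or_neg
      · refine ⟨Polynomial.C c * X ^ n, fun x => ?_⟩
        simp [fourier_apply, AddCircle.toCircle_nsmul]
      · refine ⟨Polynomial.C (conj c) * X ^ n, fun x => ?_⟩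
        rw [fourier_neg, ← Complex.conj_re]
        simp [fourier_apply, AddCircle.toCircle_nsmul]
    refine Submodule.span_induction (p := fun p _ => ∀ c : ℂ, ∃ A : ℂ[X],
      ∀ x : AddCircle (2 * π), (A.eval (AddCircle.toCircle x : ℂ)).re = (c * p x).re)
      ?_ ?_ ?_ ?_ hp 1 |>.imp fun A hA x => by simpa using hA x
    · rintro _ ⟨k, rfl⟩ c
      exact hmono k c
    · exact fun c => ⟨0, by simp⟩
    · intro p q _ _ hp hq c
      obtain ⟨A, hA⟩ := hp c
      obtain ⟨B, hB⟩ := hq c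
      exact ⟨A + B, fun x => by simp [hA, hB, mul_add]⟩
    · intro u p _ hp c
      obtain ⟨A, hA⟩ := hp (c * u)
      exact ⟨A, fun x => by rw [hA]; simp [mul_assoc]⟩
  obtain ⟨A, hA⟩ := hA
  refine ⟨A, fun z hz => ?_⟩
  obtain ⟨x, hx⟩ := (AddCircle.homeomorphCircle two_pi_pos.ne').surjective
    ⟨z, mem_sphere_zero_iff_norm.2 hz⟩
  have hxz : (AddCircle.toCircle x : ℂ) = z := by
    have := congrArg (fun w : Circle => (w : ℂ)) hx
    simpa [AddCircle.homeomorphCircle_apply] using this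
  have h1 : dist (G x) (p x) < ε := (ContinuousMap.dist_apply_le_dist x).trans_lt hpG
  have h2 : (A.eval z).re - g z = (p x - G x).re := by
    rw [← hxz, hA]
    simp [G]
  rw [h2]
  refine (Complex.abs_re_le_norm _).trans_lt ?_
  rwa [dist_comm, Complex.dist_eq] at h1

theorem norm_eval_zero_mul_sin_pow_le_of_continuous {g : ℂ → ℝ} (hg : Continuous g)
    (hg0 : ∀ z, 0 ≤ g z) (hg1 : ∀ z, g z ≤ 1) {Q : ℂ[X]} {d : ℕ} {M : ℝ} (hQ : Q.natDegree ≤ d)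
    (hM : 0 ≤ M) (hE : ∀ z : ℂ, ‖z‖ = 1 → ‖Q.eval z‖ ≤ M ∨ g z = 0) :
    ‖Q.eval 0‖ * Real.sin (π / 2 * circleAverage g 0 1) ^ (d + 1) ≤ 2 * M := by
  obtain ⟨N, hN⟩ : ∃ N, ∀ z : ℂ, ‖z‖ = 1 → ‖Q.eval z‖ ≤ N := by
    obtain ⟨N, hN⟩ := (isCompact_sphere (0 : ℂ) 1).exists_bound_of_continuousOn
      (f := fun z => Q.eval z) Q.continuous.continuousOn
    exact ⟨N, fun z hz => hN z (by simpa using hz)⟩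
  have havg : ∀ {f : ℂ → ℝ}, Continuous f → CircleIntegrable f 0 1 := fun hf =>
    hf.continuousOn.circleIntegrable'
  -- for each small `ε` there is an admissible analytic polynomial with nearly the same mean
  have key : ∀ ε : ℝ, 0 < ε → ε < 1 / 4 → ∃ y : ℝ, |y - circleAverage g 0 1| ≤ 5 * ε ∧
      ‖Q.eval 0‖ * Real.sin (π / 2 * y) ^ (d + 1)
        ≤ 2 * M + N * ((d + 1) * Real.tan (π / 2 * (2 * ε))) := by
    intro ε hε hε4
    obtain ⟨A, hA⟩ := exists_polynomial_re_eval_near hg hε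
    have h3 : (0 : ℝ) < 1 + 3 * ε := by positivity
    let A' : ℂ[X] := Polynomial.C ((1 + 3 * ε : ℝ) : ℂ)⁻¹ *
      (A + Polynomial.C (ε - (A.eval 0).im * Complex.I))
    have hA' : ∀ z, (A'.eval z).re = ((A.eval z).re + ε) / (1 + 3 * ε) := by
      intro z
      simp only [A', ← Complex.ofReal_inv, eval_mul, eval_C, Complex.re_ofReal_mul]
      simp
      field_simp
    have him : (A'.eval 0).im = 0 := by
      simp only [A', ← Complex.ofReal_inv, eval_mul, eval_C, Complex.im_ofReal_mul]
      simp
    have hdist : ∀ z : ℂ, ‖z‖ = 1 → |(A'.eval z).re - g z| ≤ 5 * ε := by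
      intro z hz
      obtain ⟨h4, h5⟩ := abs_lt.1 (hA z hz)
      have := hg0 z
      have := hg1 z
      rw [hA', abs_le, le_sub_iff_add_le, le_div_iff₀ h3, sub_le_iff_le_add, div_le_iff₀ h3]
      constructor <;> nlinarith
    have hmean : circleAverage (fun z => (A'.eval z).re) 0 1 = (A'.eval 0).re := by
      have h6 : circleAverage (fun z => A'.eval z) 0 1 = A'.eval 0 :=
        DiffContOnCl.circleAverage (f := fun z => A'.eval z) A'.differentiable.diffContOnCl
      have h7 := Complex.reCLM.circleAverage_comp_comm (f := fun z => A'.eval z) (c := 0) (R := 1)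
        A'.continuous.continuousOn.circleIntegrable'
      rw [h6] at h7
      exact h7
    refine ⟨(A'.eval 0).re, ?_, ?_⟩
    · have hc : Continuous fun z => (A'.eval z).re := Complex.continuous_re.comp A'.continuous
      rw [← hmean, ← circleAverage_fun_sub (havg hc) (havg hg)]
      refine (abs_circleAverage_le_circleAverage_abs).trans ?_
      refine circleAverage_mono_on_of_le_circle (havg (hc.sub hg).abs) ?_
      intro z hz
      exact hdist z (by simpa using hz)
    · refine norm_eval_zero_mul_sin_pow_le_s15 (r := (1 + 2 * ε) / (1 + 3 * ε)) hQ ?_ ?_ ?_ him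
        (by positivity) (by linarith) hM hN ?_
      · rw [div_lt_one h3]
        linarith
      · intro z hz
        rw [hA']
        obtain ⟨h4, h5⟩ := abs_lt.1 (hA z hz)
        have := hg0 z
        exact div_nonneg (by linarith) h3.le
      · intro z hz
        rw [hA']
        obtain ⟨h4, h5⟩ := abs_lt.1 (hA z hz)
        have := hg1 z
        rw [div_le_div_iff_of_pos_right h3]
        linarith
      · intro z hz
        refine (hE z hz).imp_right fun h0 => ?_
        obtain ⟨h4, h5⟩ := abs_lt.1 (hA z hz)
        rw [hA', div_le_iff₀ h3]
        nlinarith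
  -- let `ε → 0`
  have hev : ∀ᶠ ε : ℝ in nhdsWithin 0 (Set.Ioi 0), 0 < ε ∧ ε < 1 / 4 := by
    filter_upwards [Ioo_mem_nhdsGT (show (0 : ℝ) < 1 / 4 by norm_num)] with ε hε using hε
  choose! y hy1 hy2 using key
  have hlim : Filter.Tendsto y (nhdsWithin 0 (Set.Ioi 0)) (nhds (circleAverage g 0 1)) := by
    rw [tendsto_iff_dist_tendsto_zero]
    refine squeeze_zero' (g := fun ε => 5 * ε) (.of_forall fun _ => dist_nonneg) ?_ ?_
    · filter_upwards [hev] with ε hε using hy1 ε hε.1 hε.2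
    · have : Filter.Tendsto (fun ε : ℝ => 5 * ε) (nhds 0) (nhds (5 * 0)) :=
        (continuous_const.mul continuous_id).tendsto 0
      rw [mul_zero] at this
      exact this.mono_left nhdsWithin_le_nhds
  have hl : Filter.Tendsto (fun ε => ‖Q.eval 0‖ * Real.sin (π / 2 * y ε) ^ (d + 1))
      (nhdsWithin 0 (Set.Ioi 0))
      (nhds (‖Q.eval 0‖ * Real.sin (π / 2 * circleAverage g 0 1) ^ (d + 1))) :=
    ((((continuous_sin.tendsto _).comp (hlim.const_mul _)).pow _).const_mul _)
  have hr : Filter.Tendsto (fun ε : ℝ => 2 * M + N * ((d + 1) * Real.tan (π / 2 * (2 * ε))))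
      (nhdsWithin 0 (Set.Ioi 0)) (nhds (2 * M)) := by
    have hcont : ContinuousAt
        (fun ε : ℝ => 2 * M + N * ((d + 1) * Real.tan (π / 2 * (2 * ε)))) 0 := by
      have : ContinuousAt Real.tan (π / 2 * (2 * 0)) := continuousAt_tan.2 (by simp)
      have h2 : ContinuousAt (fun ε : ℝ => Real.tan (π / 2 * (2 * ε))) 0 :=
        ContinuousAt.comp (f := fun ε : ℝ => π / 2 * (2 * ε)) this (by fun_prop)
      fun_prop
    have := hcont.tendsto.mono_left (nhdsWithin_le_nhds (s := Set.Ioi 0))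
    simpa using this
  refine le_of_tendsto_of_tendsto hl hr ?_
  filter_upwards [hev] with ε hε using hy2 ε hε.1 hε.2

theorem le_of_forall_mul_pow_le {x y s K : ℝ} (hs : 0 < s) (hy : 0 < y)
    (h : ∀ n : ℕ, s * x ^ (n + 1) ≤ K * y ^ (n + 1)) : x ≤ y := by
  by_contra! hlt
  have h1 : 1 < x / y := (one_lt_div hy).2 hlt
  obtain ⟨n, hn⟩ := pow_unbounded_of_one_lt (K / s) h1
  have h2 : (x / y) ^ (n + 1) ≤ K / s := by
    rw [div_pow, div_le_div_iff₀ (by positivity) hs]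
    linarith [h n]
  have h3 : (x / y) ^ n ≤ (x / y) ^ (n + 1) := pow_le_pow_right₀ h1.le n.le_succ
  linarith

/-- Polynomials that agree with a real function up to a phase `u` satisfying `u ^ 2 = κ * z ^ m` on
the unit circle. -/
theorem sin_pow_le_of_phase {m : ℕ} (hm : 1 ≤ m) {h : ℝ} (hh : 0 < h) {P : ℂ[X]} {κ : ℂ}
    (hdeg : P.natDegree ≤ m) (hP0 : ‖P.eval 0‖ = 1)
    (hphase : ∀ z : ℂ, ‖z‖ = 1 → ∃ (u : ℂ) (f : ℝ), ‖u‖ = 1 ∧ P.eval z = u * f ∧ u ^ 2 = κ * z ^ m)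
    {g : ℂ → ℝ} (hg : Continuous g) (hg0 : ∀ z, 0 ≤ g z) (hg1 : ∀ z, g z ≤ 1)
    (hE : ∀ z : ℂ, h ≤ ‖P.eval z‖ → g z = 0) :
    Real.sin (π / 2 * circleAverage g 0 1) ^ m ≤ h / 2 := by
  set a : ℂ[X] := Polynomial.C (κ * (h / 2) ^ 2) * X ^ m with ha
  set D : ℕ → ℂ[X] := fun n => (dickson 1 a n).eval P with hD
  have hD0 : D 0 = 2 := by
    simp only [hD, dickson_zero]
    norm_num
  have hD1 : D 1 = P := by simp [hD]
  have hD2 : ∀ n, D (n + 2) = P * D (n + 1) - a * D n := by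
    intro n
    simp only [hD, dickson_add_two]
    simp
  have hadeg : a.natDegree ≤ m := natDegree_C_mul_X_pow_le _ _
  have degD : ∀ n, (D n).natDegree ≤ m * n := by
    intro n
    induction n using Nat.twoStepInduction with
    | zero => simp [hD0]
    | one => simpa [hD1] using hdeg
    | more n h1 h2 =>
      rw [hD2]
      refine (natDegree_sub_le _ _).trans (max_le ?_ ?_)
      · exact natDegree_mul_le.trans ((add_le_add hdeg h2).trans (by lia))
      · exact natDegree_mul_le.trans ((add_le_add hadeg h1).trans (by lia))
  have evalD0 : ∀ n, (D (n + 1)).eval 0 = P.eval 0 ^ (n + 1) := by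
    intro n
    induction n with
    | zero => simp [hD1]
    | succ n ih =>
      rw [hD2, eval_sub, eval_mul, ih, eval_mul, ha]
      simp [show m ≠ 0 by lia]
      ring
  have evalD : ∀ z : ℂ, ‖z‖ = 1 → ‖P.eval z‖ ≤ h → ∀ n, ‖(D n).eval z‖ ≤ 2 * (h / 2) ^ n := by
    intro z hz hPz n
    obtain ⟨u, f, hu, hPu, hu2⟩ := hphase z hz
    have hf : |f| ≤ h := by
      rw [hPu, norm_mul, hu, one_mul, Complex.norm_real] at hPz
      exact hPz
    obtain ⟨hf1, hf2⟩ := abs_le.1 hf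
    set θ := Real.arccos (f / h)
    have hθ : h * Real.cos θ = f := by
      rw [Real.cos_arccos]
      · field_simp
      · rw [le_div_iff₀ hh]
        linarith
      · rw [div_le_one hh]
        exact hf2
    have hval : ∀ n : ℕ, (D n).eval z = 2 * (u * (h / 2)) ^ n * (Real.cos (n * θ) : ℝ) := by
      intro n
      induction n using Nat.twoStepInduction with
      | zero => simp [hD0]
      | one =>
        rw [hD1, hPu, ← hθ]
        push_cast
        rw [one_mul]
        ring
      | more n h1 h2 =>
        have e1 : Real.cos ((n + 2 : ℕ) * θ)
            = 2 * Real.cos θ * Real.cos ((n + 1 : ℕ) * θ) - Real.cos (n * θ) := by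
          have e2 := Real.cos_add ((n + 1 : ℕ) * θ) θ
          have e3 := Real.cos_sub ((n + 1 : ℕ) * θ) θ
          rw [show ((n + 1 : ℕ) : ℝ) * θ + θ = (n + 2 : ℕ) * θ by push_cast; ring] at e2
          rw [show ((n + 1 : ℕ) : ℝ) * θ - θ = n * θ by push_cast; ring] at e3
          linarith
        rw [hD2, eval_sub, eval_mul, eval_mul, h1, h2, hPu, e1, ← hθ, ha, eval_mul, eval_C,
          eval_pow, eval_X,
          show κ * (h / 2 : ℂ) ^ 2 * z ^ m = u ^ 2 * (h / 2 : ℂ) ^ 2 by rw [hu2]; ring]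
        push_cast
        ring
    rw [hval, norm_mul, norm_mul, norm_pow, norm_mul, hu, Complex.norm_real]
    have e4 : ‖(h / 2 : ℂ)‖ = h / 2 := by
      rw [norm_div, Complex.norm_real, Real.norm_eq_abs, abs_of_pos hh]
      simp
    rw [e4, one_mul, Complex.norm_two]
    exact mul_le_of_le_one_right (by positivity) (Real.abs_cos_le_one _)
  have hint : CircleIntegrable g 0 1 := hg.continuousOn.circleIntegrable'
  have hy0 : 0 ≤ circleAverage g 0 1 := circleAverage_nonneg_of_nonneg fun z _ => hg0 z
  have hy1 : circleAverage g 0 1 ≤ 1 := circleAverage_mono_on_of_le_circle hint fun z _ => hg1 z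
  set s := Real.sin (π / 2 * circleAverage g 0 1) with hs
  have hs0 : 0 ≤ s := sin_nonneg_of_nonneg_of_le_pi (by positivity) (by nlinarith [pi_pos])
  rcases hs0.eq_or_lt with h0 | hpos
  · rw [← h0, zero_pow (by lia)]
    positivity
  refine le_of_forall_mul_pow_le (K := 4) hpos (by positivity) fun n => ?_
  have := norm_eval_zero_mul_sin_pow_le_of_continuous hg hg0 hg1 (degD (n + 1))
    (M := 2 * (h / 2) ^ (n + 1)) (by positivity) (by
      intro z hz
      rcases le_total h ‖P.eval z‖ with h1 | h1
      · exact .inr (hE z h1)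
      · exact .inl (evalD z hz h1 _))
  rw [evalD0, norm_pow, hP0, one_pow, one_mul, ← hs, pow_succ, pow_mul] at this
  linarith

theorem sub_exp_eq_mul_sin (t φ : ℝ) :
    Complex.exp (t * Complex.I) - Complex.exp (φ * Complex.I) =
      Complex.I * Complex.exp ((t + φ) / 2 * Complex.I) * (2 * Real.sin ((t - φ) / 2) : ℝ) := by
  push_cast
  rw [Complex.sin,
    show (t : ℂ) * Complex.I = (t + φ) / 2 * Complex.I + (t - φ) / 2 * Complex.I by ring,
    show (φ : ℂ) * Complex.I = (t + φ) / 2 * Complex.I + -((t - φ) / 2) * Complex.I by ring,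
    Complex.exp_add, Complex.exp_add]
  linear_combination (Complex.exp ((t + φ) / 2 * Complex.I) *
    (Complex.exp ((t - φ) / 2 * Complex.I) - Complex.exp (-((t - φ) / 2) * Complex.I))) *
    Complex.I_sq

theorem sin_quarter_measure_pow_le {m : ℕ} (hm : 1 ≤ m) {h : ℝ} (hh : 0 < h) (φ : Fin m → ℝ) :
    Real.sin (volume.real {t : ℝ | t ∈ Set.Ioc 0 (2 * π) ∧
      ∏ j, |2 * Real.sin ((t - φ j) / 2)| < h} / 4) ^ m ≤ h / 2 := by
  set P : ℂ[X] := ∏ j, (X - Polynomial.C (Complex.exp (φ j * Complex.I))) with hP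
  have hnorm : ∀ t : ℝ, ‖P.eval (circleMap 0 1 t)‖ = ∏ j, |2 * Real.sin ((t - φ j) / 2)| := by
    intro t
    rw [hP, eval_prod, norm_prod]
    refine Finset.prod_congr rfl fun j _ => ?_
    simp only [eval_sub, eval_X, eval_C, circleMap_zero, Complex.ofReal_one, one_mul]
    rw [sub_exp_eq_mul_sin, norm_mul, norm_mul, Complex.norm_I, Complex.norm_real]
    rw [show ((t : ℂ) + φ j) / 2 * Complex.I = (((t + φ j) / 2 : ℝ) : ℂ) * Complex.I by
        push_cast; ring,
      Complex.norm_exp_ofReal_mul_I]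
    simp
  have hphase : ∀ z : ℂ, ‖z‖ = 1 → ∃ (u : ℂ) (f : ℝ), ‖u‖ = 1 ∧ P.eval z = u * f ∧
      u ^ 2 = (∏ j, -Complex.exp (φ j * Complex.I)) * z ^ m := by
    intro z hz
    obtain ⟨t, rfl⟩ : ∃ t : ℝ, Complex.exp (t * Complex.I) = z :=
      ⟨Complex.arg z, by simpa [hz] using Complex.norm_mul_exp_arg_mul_I z⟩
    refine ⟨∏ j, (Complex.I * Complex.exp ((t + φ j) / 2 * Complex.I)),
      ∏ j, (2 * Real.sin ((t - φ j) / 2)), ?_, ?_, ?_⟩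
    · rw [norm_prod]
      refine Finset.prod_eq_one fun j _ => ?_
      rw [show ((t : ℂ) + φ j) / 2 * Complex.I = (((t + φ j) / 2 : ℝ) : ℂ) * Complex.I by
        push_cast; ring,
        norm_mul, Complex.norm_exp_ofReal_mul_I, Complex.norm_I, one_mul]
    · rw [hP, eval_prod, Complex.ofReal_prod, ← Finset.prod_mul_distrib]
      refine Finset.prod_congr rfl fun j _ => ?_
      simp only [eval_sub, eval_X, eval_C]
      exact sub_exp_eq_mul_sin t (φ j)
    · have : Complex.exp (t * Complex.I) ^ m = ∏ _j : Fin m, Complex.exp (t * Complex.I) := by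
        simp
      rw [this, ← Finset.prod_mul_distrib, ← Finset.prod_pow]
      refine Finset.prod_congr rfl fun j _ => ?_
      rw [mul_pow, Complex.I_sq, ← Complex.exp_nat_mul, neg_mul, neg_mul, one_mul, ← Complex.exp_add]
      congr 2
      push_cast
      ring
  have hdeg : P.natDegree ≤ m := by
    rw [hP, natDegree_prod_of_monic _ _ fun j _ => monic_X_sub_C _]
    simp
  have hP0 : ‖P.eval 0‖ = 1 := by
    rw [hP, eval_prod, norm_prod]
    refine Finset.prod_eq_one fun j _ => ?_
    simp [Complex.norm_exp_ofReal_mul_I]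
  let g : ℕ → ℂ → ℝ := fun n z => max 0 (min 1 (n * (h - ‖P.eval z‖)))
  have hg : ∀ n, Continuous (g n) := by
    intro n
    have := P.continuous
    fun_prop
  have hg0 : ∀ n z, 0 ≤ g n z := fun n z => le_max_left _ _
  have hg1 : ∀ n z, g n z ≤ 1 := fun n z => max_le zero_le_one (min_le_left _ _)
  have hgE : ∀ n z, h ≤ ‖P.eval z‖ → g n z = 0 := by
    intro n z hz
    refine max_eq_left ((min_le_right _ _).trans ?_)
    exact mul_nonpos_of_nonneg_of_nonpos n.cast_nonneg (by linarith)
  set S : Set ℝ := {t : ℝ | ∏ j, |2 * Real.sin ((t - φ j) / 2)| < h} with hS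
  have hSm : MeasurableSet S := measurableSet_lt (by fun_prop) measurable_const
  have hlim : Filter.Tendsto (fun n => circleAverage (g n) 0 1) Filter.atTop
      (nhds ((2 * π)⁻¹ * volume.real (S ∩ Set.Ioc 0 (2 * π)))) := by
    have hint : volume.real (S ∩ Set.Ioc 0 (2 * π)) =
        ∫ t in Set.Ioc 0 (2 * π), S.indicator (fun _ => (1 : ℝ)) t := by
      rw [integral_indicator hSm, Measure.restrict_restrict hSm]
      simp
    simp only [circleAverage, intervalIntegral.integral_of_le two_pi_pos.le, smul_eq_mul, hint]
    refine Filter.Tendsto.const_mul _ ?_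
    refine tendsto_integral_of_dominated_convergence (fun _ => 1) ?_ (by simp) ?_ ?_
    · intro n
      exact ((hg n).comp (continuous_circleMap 0 1)).aestronglyMeasurable
    · intro n
      refine .of_forall fun t => ?_
      rw [Real.norm_eq_abs, abs_of_nonneg (hg0 _ _)]
      exact hg1 _ _
    · refine .of_forall fun t => ?_
      by_cases ht : t ∈ S
      · rw [Set.indicator_of_mem ht]
        have hpos : 0 < h - ‖P.eval (circleMap 0 1 t)‖ := by
          rw [hnorm]
          exact sub_pos.2 ht
        obtain ⟨k, hk⟩ := exists_nat_gt (1 / (h - ‖P.eval (circleMap 0 1 t)‖))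
        refine tendsto_const_nhds.congr' ?_
        filter_upwards [Filter.eventually_ge_atTop k] with n hn
        have h1 : 1 ≤ n * (h - ‖P.eval (circleMap 0 1 t)‖) := by
          rw [div_lt_iff₀ hpos] at hk
          have : (k : ℝ) ≤ n := by exact_mod_cast hn
          nlinarith
        simp only [g]
        rw [min_eq_left h1, max_eq_right zero_le_one]
      · rw [Set.indicator_of_notMem ht]
        refine tendsto_const_nhds.congr fun n => (hgE n _ ?_).symm
        rw [hnorm]
        exact not_lt.1 ht
  have hset : {t : ℝ | t ∈ Set.Ioc 0 (2 * π) ∧ ∏ j, |2 * Real.sin ((t - φ j) / 2)| < h}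
      = S ∩ Set.Ioc 0 (2 * π) := by
    ext t
    exact and_comm
  have e : volume.real (S ∩ Set.Ioc 0 (2 * π)) / 4 =
      π / 2 * ((2 * π)⁻¹ * volume.real (S ∩ Set.Ioc 0 (2 * π))) := by
    field_simp
    ring
  rw [hset, e]
  refine le_of_tendsto' (((continuous_sin.tendsto _).comp (hlim.const_mul _)).pow m) fun n => ?_
  exact sin_pow_le_of_phase hm hh hdeg hP0 hphase (hg n) (hg0 n) (hg1 n) (hgE n)

theorem eval_T_real_eq_prod (n : ℕ) (x : ℝ) :
    (Polynomial.Chebyshev.T ℝ n).eval x =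
      2 ^ (n - 1) * ∏ k ∈ Finset.range n, (x - Real.cos ((2 * k + 1) * π / (2 * n))) := by
  have hroots := Polynomial.Chebyshev.roots_T_real n
  have hinj := (Finset.range n).nodup_map_iff_injOn.mp (Polynomial.Chebyshev.roots_T_real_nodup n)
  have hcard : (Polynomial.Chebyshev.T ℝ n).roots.card =
      (Polynomial.Chebyshev.T ℝ n).natDegree := by
    rw [hroots, Finset.card_val, Finset.card_image_of_injOn hinj]
    simp
  have h := C_leadingCoeff_mul_prod_multiset_X_sub_C hcard
  rw [hroots] at h
  change _ * ∏ y ∈ Finset.image _ _, (X - Polynomial.C y) = _ at h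
  rw [Finset.prod_image hinj] at h
  rw [← h]
  simp [eval_prod]

theorem prod_abs_two_mul_sin_eq {n : ℕ} (hn : n ≠ 0) {c : ℝ} (hc0 : 0 < c) (hc1 : c ≤ 1) (s : ℝ) :
    ∏ k ∈ Finset.range n,
        |2 * Real.sin (s - Real.arccos (c * Real.cos ((2 * k + 1) * π / (2 * n))))| =
      2 * c ^ n * |(Polynomial.Chebyshev.T ℝ n).eval (Real.cos s / c)| := by
  set x : ℕ → ℝ := fun k => Real.cos ((2 * k + 1) * π / (2 * n)) with hx
  set σ : ℕ → ℝ := fun k => Real.arccos (c * x k) with hσ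
  have hn0 : (n : ℝ) ≠ 0 := by exact_mod_cast hn
  have hxr : ∀ k ∈ Finset.range n, x (n - 1 - k) = -x k := by
    intro k hk
    have hk' : k + 1 ≤ n := Finset.mem_range.1 hk
    simp only [hx]
    rw [← Real.cos_pi_sub, show n - 1 - k = n - (k + 1) by lia, Nat.cast_sub hk']
    congr 1
    push_cast
    field_simp
    ring
  have hσr : ∀ k ∈ Finset.range n, σ (n - 1 - k) = π - σ k := by
    intro k hk
    simp only [hσ]
    rw [hxr k hk, mul_neg, Real.arccos_neg]
  have hcosσ : ∀ k, Real.cos (σ k) = c * x k := by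
    intro k
    have h1 : |c * x k| ≤ 1 := by
      rw [abs_mul, abs_of_pos hc0]
      exact mul_le_one₀ hc1 (abs_nonneg _) (Real.abs_cos_le_one _)
    exact Real.cos_arccos (abs_le.1 h1).1 (abs_le.1 h1).2
  have hT : 2 * c ^ n * (Polynomial.Chebyshev.T ℝ n).eval (Real.cos s / c) =
      ∏ k ∈ Finset.range n, (2 * Real.cos s - 2 * (c * x k)) := by
    rw [eval_T_real_eq_prod n]
    have e : ∀ k ∈ Finset.range n,
        2 * Real.cos s - 2 * (c * x k) = (2 * c) * (Real.cos s / c - x k) := by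
      intro k _
      field_simp
    rw [Finset.prod_congr rfl e, Finset.prod_mul_distrib, Finset.prod_const, Finset.card_range,
      mul_pow]
    obtain ⟨j, rfl⟩ := Nat.exists_eq_succ_of_ne_zero hn
    simp only [Nat.succ_eq_add_one, Nat.add_sub_cancel]
    ring
  have hsq : (∏ k ∈ Finset.range n, (2 * Real.sin (s - σ k))) ^ 2 =
      (∏ k ∈ Finset.range n, (2 * Real.cos s - 2 * (c * x k))) ^ 2 := by
    rw [sq, sq]
    nth_rewrite 2 [← Finset.prod_range_reflect]
    nth_rewrite 4 [← Finset.prod_range_reflect]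
    rw [← Finset.prod_mul_distrib, ← Finset.prod_mul_distrib]
    refine Finset.prod_congr rfl fun k hk => ?_
    rw [hσr k hk, hxr k hk, mul_neg, ← hcosσ,
      show s - (π - σ k) = (s + σ k) - π by ring, Real.sin_sub_pi, Real.sin_sub, Real.sin_add]
    have h1 := Real.sin_sq_add_cos_sq s
    have h2 := Real.sin_sq_add_cos_sq (σ k)
    linear_combination (4 * Real.cos s ^ 2) * h2 - (4 * Real.cos (σ k) ^ 2) * h1
  have hc2 : 0 < 2 * c ^ n := by positivity
  rw [← Finset.abs_prod, (sq_eq_sq_iff_abs_eq_abs _ _).1 hsq, ← hT, abs_mul, abs_of_pos hc2]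

theorem exists_measure_le {m : ℕ} (hm : 1 ≤ m) {h c : ℝ} (hc0 : 0 < c) (hc1 : c ≤ 1)
    (hch : 2 * c ^ m < h) :
    ∃ φ : Fin m → ℝ, (volume {t : ℝ | t ∈ Set.Ico 0 (2 * Real.pi) ∧
          h ≤ ∏ j, |2 * Real.sin ((t - φ j) / 2)|}).toReal ≤ 4 * Real.arccos c := by
  refine ⟨fun j => 2 * Real.arccos (c * Real.cos ((2 * (j : ℕ) + 1) * π / (2 * m))), ?_⟩
  have hsub : {t : ℝ | t ∈ Set.Ico 0 (2 * Real.pi) ∧ h ≤ ∏ j : Fin m, |2 * Real.sin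
      ((t - 2 * Real.arccos (c * Real.cos ((2 * (j : ℕ) + 1) * π / (2 * m)))) / 2)|} ⊆
      Set.Icc 0 (2 * Real.arccos c) ∪ Set.Icc (2 * π - 2 * Real.arccos c) (2 * π) := by
    rintro t ⟨⟨ht0, ht1⟩, ht⟩
    have e : ∏ j : Fin m, |2 * Real.sin
        ((t - 2 * Real.arccos (c * Real.cos ((2 * (j : ℕ) + 1) * π / (2 * m)))) / 2)| =
        2 * c ^ m * |(Polynomial.Chebyshev.T ℝ m).eval (Real.cos (t / 2) / c)| := by
      rw [← prod_abs_two_mul_sin_eq (by lia) hc0 hc1, Finset.prod_range]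
      refine Finset.prod_congr rfl fun j _ => ?_
      congr 3
      ring
    rw [e] at ht
    by_contra hnot
    simp only [Set.mem_union, Set.mem_Icc, not_or, not_and, not_le] at hnot
    obtain ⟨h1, h2⟩ := hnot
    have h1 := h1 ht0
    have h2 : t < 2 * π - 2 * Real.arccos c := by
      by_contra! h3
      linarith [h2 h3]
    have harc := Real.arccos_nonneg c
    have hcosa : Real.cos (Real.arccos c) = c := Real.cos_arccos (by linarith) hc1
    have h4 : Real.cos (t / 2) ≤ c := by
      rw [← hcosa]
      exact Real.cos_le_cos_of_nonneg_of_le_pi harc (by linarith) (by linarith)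
    have h5 : -c ≤ Real.cos (t / 2) := by
      rw [← hcosa, ← Real.cos_pi_sub]
      exact Real.cos_le_cos_of_nonneg_of_le_pi (by linarith) (by linarith) (by linarith)
    have h6 : |(Polynomial.Chebyshev.T ℝ m).eval (Real.cos (t / 2) / c)| ≤ 1 := by
      refine Polynomial.Chebyshev.abs_eval_T_real_le_one m ?_
      rw [abs_div, abs_of_pos hc0, div_le_one hc0]
      exact abs_le.2 ⟨h5, h4⟩
    have : 2 * c ^ m * |(Polynomial.Chebyshev.T ℝ m).eval (Real.cos (t / 2) / c)| ≤ 2 * c ^ m :=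
      mul_le_of_le_one_right (by positivity) h6
    linarith
  have harc := Real.arccos_nonneg c
  refine (measureReal_mono hsub (measure_union_ne_top measure_Icc_lt_top.ne
    measure_Icc_lt_top.ne)).trans ((measureReal_union_le _ _).trans ?_)
  rw [Real.volume_real_Icc_of_le (by linarith), Real.volume_real_Icc_of_le (by linarith)]
  linarith

theorem four_mul_arccos_le_measure {m : ℕ} (hm : 1 ≤ m) {h : ℝ} (hh : 0 < h) (φ : Fin m → ℝ) :
    4 * Real.arccos ((h / 2) ^ ((1 : ℝ) / m)) ≤
      (volume {t : ℝ | t ∈ Set.Ico 0 (2 * Real.pi) ∧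
          h ≤ ∏ j, |2 * Real.sin ((t - φ j) / 2)|}).toReal := by
  set S : Set ℝ := {t : ℝ | ∏ j, |2 * Real.sin ((t - φ j) / 2)| < h} with hS
  have hSm : MeasurableSet S := measurableSet_lt (by fun_prop) measurable_const
  have hkey := sin_quarter_measure_pow_le hm hh φ
  have hset : {t : ℝ | t ∈ Set.Ioc 0 (2 * π) ∧ ∏ j, |2 * Real.sin ((t - φ j) / 2)| < h}
      = Set.Ioc 0 (2 * π) ∩ S := rfl
  have hset' : {t : ℝ | t ∈ Set.Ico 0 (2 * π) ∧ h ≤ ∏ j, |2 * Real.sin ((t - φ j) / 2)|}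
      = Set.Ico 0 (2 * π) \ S := by
    ext t
    simp [hS]
  have hae : volume.real (Set.Ico 0 (2 * π) \ S) = volume.real (Set.Ioc 0 (2 * π) \ S) := by
    rw [measureReal_def, measureReal_def]
    congr 1
    exact measure_congr (ae_eq_set_sdiff Ico_ae_eq_Ioc (ae_eq_refl S))
  have hsum := measureReal_inter_add_sdiff (μ := volume) (s := Set.Ioc 0 (2 * π)) hSm
    measure_Ioc_lt_top.ne
  rw [Real.volume_real_Ioc_of_le two_pi_pos.le, sub_zero] at hsum
  rw [hset] at hkey
  rw [hset']
  change _ ≤ volume.real _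
  rw [hae]
  set ℓ := volume.real (Set.Ioc 0 (2 * π) ∩ S)
  set v := volume.real (Set.Ioc 0 (2 * π) \ S)
  have hℓ : 0 ≤ ℓ := measureReal_nonneg
  have hv : 0 ≤ v := measureReal_nonneg
  have hm0 : (m : ℝ) ≠ 0 := by exact_mod_cast (show m ≠ 0 by lia)
  have hsin0 : 0 ≤ Real.sin (ℓ / 4) := sin_nonneg_of_nonneg_of_le_pi (by linarith) (by linarith)
  have h1 : Real.sin (ℓ / 4) ≤ (h / 2) ^ ((1 : ℝ) / m) := by
    have := Real.rpow_le_rpow (by positivity) hkey (show 0 ≤ (1 : ℝ) / m by positivity)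
    rwa [← Real.rpow_natCast, ← Real.rpow_mul hsin0, mul_one_div_cancel hm0, Real.rpow_one] at this
  have h2 : Real.cos (v / 4) = Real.sin (ℓ / 4) := by
    rw [← Real.cos_pi_div_two_sub]
    congr 1
    linarith
  rw [← h2] at h1
  have h3 := Real.arccos_le_arccos h1
  rw [Real.arccos_cos (by linarith) (by linarith [pi_pos])] at h3
  linarith

theorem stmt_15 (m : ℕ) (hm : 1 ≤ m) (h : ℝ) (hh : 0 < h) (hh2 : h < 2) :
    sInf {μ : ℝ | ∃ φ : Fin m → ℝ,
        μ = (volume {t : ℝ | t ∈ Set.Ico 0 (2 * Real.pi) ∧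
          h ≤ ∏ j, |2 * Real.sin ((t - φ j) / 2)|}).toReal}
      = 4 * Real.arccos ((h / 2) ^ ((1 : ℝ) / m)) := by
  have hlb : ∀ μ ∈ {μ : ℝ | ∃ φ : Fin m → ℝ,
      μ = (volume {t : ℝ | t ∈ Set.Ico 0 (2 * Real.pi) ∧
        h ≤ ∏ j, |2 * Real.sin ((t - φ j) / 2)|}).toReal},
      4 * Real.arccos ((h / 2) ^ ((1 : ℝ) / m)) ≤ μ := by
    rintro _ ⟨φ, rfl⟩
    exact four_mul_arccos_le_measure hm hh φ
  refine le_antisymm ?_ (le_csInf ⟨_, 0, rfl⟩ hlb)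
  set c : ℝ := (h / 2) ^ ((1 : ℝ) / m) with hc
  have hm0 : m ≠ 0 := by lia
  have hc0 : 0 < c := Real.rpow_pos_of_pos (by positivity) _
  have hc1 : c ≤ 1 := Real.rpow_le_one (by positivity) (by linarith) (by positivity)
  have hcm : c ^ m = h / 2 := by
    rw [hc, one_div, Real.rpow_inv_natCast_pow (by positivity) hm0]
  have hlim : Filter.Tendsto (fun x => 4 * Real.arccos x) (nhdsWithin c (Set.Iio c))
      (nhds (4 * Real.arccos c)) :=
    ((continuous_const.mul Real.continuous_arccos).tendsto c).mono_left nhdsWithin_le_nhds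
  refine ge_of_tendsto hlim ?_
  filter_upwards [Ioo_mem_nhdsLT hc0] with x hx
  have hxc : x ^ m < c ^ m := pow_lt_pow_left₀ hx.2 hx.1.le hm0
  obtain ⟨φ, hφ⟩ := exists_measure_le hm (h := h) hx.1 (hx.2.le.trans hc1) (by linarith)
  exact (csInf_le ⟨_, hlb⟩ ⟨φ, rfl⟩).trans hφ
end
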